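/- There exist ε₀ > 0 and M such that for all integers m ≥ M and all integers r with 2 ≤ r ≤ ε₀·(log m)/(log log m), the number of K_{r+1}-free graphs on vertex set {1,…,m} that are m^{3/5}-far from being r-partite is at most 2^{ex(m, K_{r+1})}·e^{−m·(log m)³/2}. -/

import Mathlib

open scoped Classical

/-- The number of monochromatic edges of `H` under the `r`-coloring `f`. -/
noncomputable def monoEdges {m r : ℕ} (H : SimpleGraph (Fin m)) (f : Fin m → Fin r) : ℕ :=
  {e ∈ H.edgeSet | ∃ c, ∀ v ∈ e, f v = c}.ncard

/-- `H` is `t`-far from being `r`-partite: every partition of its vertex set into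
`r` parts leaves more than `t` edges inside the parts. -/
def GraphFarFromPartite {m : ℕ} (H : SimpleGraph (Fin m)) (r : ℕ) (t : ℝ) : Prop :=
  ∀ f : Fin m → Fin r, t < (monoEdges H f : ℝ)

/-- `ex(m, K_{r+1})`: the maximum number of edges of a `K_{r+1}`-free graph on `m`
vertices. -/
noncomputable def exKr (m r : ℕ) : ℕ :=
  sSup {c | ∃ H : SimpleGraph (Fin m), H.CliqueFree (r + 1) ∧ H.edgeSet.ncard = c}

set_option linter.unusedSectionVars false

section Containers

variable {V : Type*} [Fintype V] [DecidableEq V]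

/-- The neighbours of `x` inside `N`, with respect to the edge set `C`. -/
noncomputable def nbIn (C : Finset (Sym2 V)) (N : Finset V) (x : V) : Finset V :=
  N.filter fun y => s(x, y) ∈ C

/-- `N` contains a clique on `k` vertices of the edge set `G`. -/
def HasClique (G : Finset (Sym2 V)) (k : ℕ) (N : Finset V) : Prop :=
  ∃ S ⊆ N, S.card = k ∧ ∀ x ∈ S, ∀ y ∈ S, x ≠ y → s(x, y) ∈ G

/-- Robust supersaturation: a clique on `k` vertices can be built greedily inside `N`, with
at least `d` choices at every step. -/
def Rich (C : Finset (Sym2 V)) (d : ℝ) : ℕ → Finset V → Prop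
  | 0, _ => True
  | k + 1, N => d ≤ ((N.filter fun x => Rich C d k (nbIn C N x)).card : ℝ)

/-- The candidates for a large subset of `N` which meets a non-rich subset of `N` in few
vertices. -/
noncomputable def sparseFam (C : Finset (Sym2 V)) (d : ℝ) : ℕ → Finset V → Finset (Finset V)
  | 0, _ => ∅
  | k + 1, N => insert (N.filter fun x => Rich C d k (nbIn C N x))
      (Finset.univ.biUnion fun x => sparseFam C d k (nbIn C N x))

lemma nbIn_subset (C : Finset (Sym2 V)) (N : Finset V) (x : V) : nbIn C N x ⊆ N :=
  Finset.filter_subset _ _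

lemma mem_nbIn {C : Finset (Sym2 V)} {N : Finset V} {x y : V} :
    y ∈ nbIn C N x ↔ y ∈ N ∧ s(x, y) ∈ C := by
  simp [nbIn]

lemma card_sparseFam_succ_le [Nonempty V] (C : Finset (Sym2 V)) (d : ℝ) (k : ℕ) (N : Finset V) :
    (sparseFam C d k N).card + 1 ≤ (Fintype.card V + 1) ^ k := by
  induction k generalizing N with
  | zero => simp [sparseFam]
  | succ k ih =>
    have hn : 1 ≤ Fintype.card V := Fintype.card_pos
    have h1 := Finset.card_insert_le (N.filter fun x => Rich C d k (nbIn C N x))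
      (Finset.univ.biUnion fun x => sparseFam C d k (nbIn C N x))
    have h2 : (Finset.univ.biUnion fun x => sparseFam C d k (nbIn C N x)).card ≤
        Fintype.card V * ((Fintype.card V + 1) ^ k - 1) := by
      refine Finset.card_biUnion_le_card_mul _ _ _ fun x _ => ?_
      have := ih (nbIn C N x)
      omega
    have h3 : 1 ≤ (Fintype.card V + 1) ^ k := Nat.one_le_pow _ _ (by omega)
    obtain ⟨a, ha⟩ := Nat.exists_eq_add_of_le h3
    rw [sparseFam, pow_succ]
    rw [ha] at h2 ⊢
    simp only [Nat.add_sub_cancel_left] at h2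
    nlinarith

lemma exists_mem_sparseFam (C : Finset (Sym2 V)) (d d' : ℝ) (k : ℕ) (N A : Finset V)
    (hA : A ⊆ N) (hN : Rich C d k N) (hA' : ¬ Rich C d' k A) :
    ∃ D ∈ sparseFam C d k N, D ⊆ N ∧ d ≤ D.card ∧ ((A ∩ D).card : ℝ) < d' := by
  induction k generalizing N A with
  | zero => exact absurd trivial hA'
  | succ k ih =>
    by_cases h : ∃ x ∈ A ∩ N.filter (fun x => Rich C d k (nbIn C N x)), ¬ Rich C d' k (nbIn C A x)
    · obtain ⟨x, hx, hx'⟩ := h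
      simp only [Finset.mem_inter, Finset.mem_filter] at hx
      obtain ⟨D, hD, hDN, h1, h2⟩ := ih (nbIn C N x) (nbIn C A x)
        (Finset.filter_subset_filter _ hA) hx.2.2 hx'
      refine ⟨D, ?_, hDN.trans (nbIn_subset _ _ _), h1, ?_⟩
      · rw [sparseFam, Finset.mem_insert, Finset.mem_biUnion]
        exact Or.inr ⟨x, Finset.mem_univ _, hD⟩
      · refine lt_of_le_of_lt ?_ h2
        norm_cast
        refine Finset.card_le_card fun y hy => ?_
        rw [Finset.mem_inter] at hy ⊢
        exact ⟨mem_nbIn.2 ⟨hy.1, (mem_nbIn.1 (hDN hy.2)).2⟩, hy.2⟩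
    · push Not at h
      refine ⟨_, Finset.mem_insert_self _ _, Finset.filter_subset _ _, hN, ?_⟩
      rw [Rich, not_le] at hA'
      refine lt_of_le_of_lt ?_ hA'
      norm_cast
      refine Finset.card_le_card fun y hy => ?_
      exact Finset.mem_filter.2 ⟨(Finset.mem_inter.1 hy).1, h y hy⟩

lemma exists_stuck (C G : Finset (Sym2 V)) (hG : ∀ x, s(x, x) ∉ G) (d : ℕ → ℝ) (k j : ℕ)
    (U : Finset V) (hU : Rich C (d j) k U) (hclq : ¬ HasClique G k U) :
    ∃ j' k', j' + k' + 1 = j + k ∧ ∃ U' : Finset V, Rich C (d j') (k' + 1) U' ∧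
      ∀ x ∈ U', Rich C (d j') k' (nbIn C U' x) →
        ¬ Rich C (d (j' + 1)) k' (nbIn (C ∩ G) U' x) := by
  induction k generalizing j U with
  | zero => exact absurd ⟨∅, by simp⟩ hclq
  | succ k ih =>
    by_cases h : ∃ x ∈ U, Rich C (d (j + 1)) k (nbIn (C ∩ G) U x)
    · obtain ⟨x, hx, hx'⟩ := h
      obtain ⟨j', k', hjk, h'⟩ := ih (j + 1) _ hx' (by
        rintro ⟨S, hS, hSk, hSG⟩
        have hSx : ∀ y ∈ S, s(x, y) ∈ G := fun y hy =>
          (Finset.mem_inter.1 (mem_nbIn.1 (hS hy)).2).2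
        have hxS : x ∉ S := fun hxS => hG x (hSx x hxS)
        refine hclq ⟨insert x S, ?_, by rw [Finset.card_insert_of_notMem hxS, hSk], ?_⟩
        · exact Finset.insert_subset hx (hS.trans (nbIn_subset _ _ _))
        · intro a ha b hb hab
          rcases Finset.mem_insert.1 ha with ha' | ha'
          · rcases Finset.mem_insert.1 hb with hb' | hb'
            · exact absurd (ha'.trans hb'.symm) hab
            · rw [ha']; exact hSx b hb'
          · rcases Finset.mem_insert.1 hb with hb' | hb'
            · rw [hb', Sym2.eq_swap]; exact hSx a ha'
            · exact hSG a ha' b hb' hab)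
      exact ⟨j', k', by omega, h'⟩
    · push Not at h
      exact ⟨j, k, by omega, U, hU, fun x hx _ => h x hx⟩

lemma card_ordered_pairs (S : Finset (Sym2 V)) (hS : ∀ e ∈ S, ¬ e.IsDiag) :
    (Finset.univ.filter fun p : V × V => s(p.1, p.2) ∈ S).card = 2 * S.card := by
  rw [Finset.card_eq_sum_card_fiberwise (f := fun p : V × V => s(p.1, p.2)) (t := S)
    (fun p hp => by simpa using hp)]
  rw [Finset.sum_const_nat (m := 2), mul_comm]
  intro e he
  induction e using Sym2.ind with
  | _ a b =>
    have hab : a ≠ b := by simpa using hS _ he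
    have : (Finset.univ.filter fun p : V × V => s(p.1, p.2) ∈ S).filter
        (fun p => s(p.1, p.2) = s(a, b)) = {(a, b), (b, a)} := by
      ext ⟨x, y⟩
      simp only [Finset.mem_filter, Finset.mem_univ, true_and, Finset.mem_insert,
        Finset.mem_singleton, Sym2.eq_iff, Prod.mk.injEq]
      constructor
      · exact fun h => h.2
      · intro h
        refine ⟨?_, h⟩
        rcases h with ⟨rfl, rfl⟩ | ⟨rfl, rfl⟩
        · exact he
        · rwa [Sym2.eq_swap]
    rw [this, Finset.card_pair]
    simp [hab]

/-- The edges `s(x, y)` with `y ∈ D x`. -/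
noncomputable def starEdges (D : V → Finset V) : Finset (Sym2 V) :=
  Finset.univ.biUnion fun x => (D x).image fun y => s(x, y)

lemma mem_starEdges {D : V → Finset V} {x y : V} :
    s(x, y) ∈ starEdges D ↔ y ∈ D x ∨ x ∈ D y := by
  simp only [starEdges, Finset.mem_biUnion, Finset.mem_univ, true_and, Finset.mem_image,
    Sym2.eq_iff]
  constructor
  · rintro ⟨a, b, hb, ⟨rfl, rfl⟩ | ⟨rfl, rfl⟩⟩ <;> simp [hb]
  · rintro (h | h)
    · exact ⟨x, y, h, by simp⟩
    · exact ⟨y, x, h, by simp⟩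

/-- The candidate sparse edge sets of `C`, indexed by level, ambient set and stars. -/
noncomputable def edgeFam (C : Finset (Sym2 V)) (d : ℕ → ℝ) (k : ℕ) :
    Finset (Finset (Sym2 V)) :=
  (Finset.range k).biUnion fun j => Finset.univ.biUnion fun U : Finset V =>
    (Fintype.piFinset fun x => insert ∅ (sparseFam C (d j) (k - 1 - j) (nbIn C U x))).image
      starEdges

lemma card_edgeFam_le [Nonempty V] (C : Finset (Sym2 V)) (d : ℕ → ℝ) (k : ℕ) :
    (edgeFam C d k).card ≤
      k * (2 ^ Fintype.card V * ((Fintype.card V + 1) ^ k) ^ Fintype.card V) := by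
  have h : (edgeFam C d k).card ≤ (Finset.range k).card *
      (2 ^ Fintype.card V * ((Fintype.card V + 1) ^ k) ^ Fintype.card V) := by
    refine Finset.card_biUnion_le_card_mul _ _ _ fun j _ => ?_
    refine (Finset.card_biUnion_le_card_mul _ _
      (((Fintype.card V + 1) ^ k) ^ Fintype.card V) fun U _ => ?_).trans ?_
    · refine Finset.card_image_le.trans ?_
      rw [Fintype.card_piFinset]
      refine (Finset.prod_le_pow_card _ _ ((Fintype.card V + 1) ^ k) fun x _ => ?_).trans ?_
      · refine (Finset.card_insert_le _ _).trans ((card_sparseFam_succ_le _ _ _ _).trans ?_)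
        exact Nat.pow_le_pow_right (by omega) (by omega)
      · simp
    · simp
  simpa using h

lemma exists_mem_edgeFam (C G : Finset (Sym2 V)) (hC : ∀ e ∈ C, ¬ e.IsDiag)
    (hG : ∀ e ∈ G, ¬ e.IsDiag) (d : ℕ → ℝ) (τ : ℝ) (hτ : 0 ≤ τ) (hd0 : ∀ j, 0 ≤ d j)
    (hd : ∀ j, d (j + 1) = τ * d j) (hanti : Antitone d) (k : ℕ)
    (hU : Rich C (d 0) k Finset.univ) (hclq : ¬ HasClique G k Finset.univ) :
    ∃ R ∈ edgeFam C d k, R ⊆ C ∧ d k ^ 2 ≤ 2 * R.card ∧ ((G ∩ R).card : ℝ) ≤ 2 * τ * R.card := by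
  obtain ⟨j, k', hjk, U, hU, hstuck⟩ := exists_stuck C G (fun x hx => hG _ hx rfl) d k 0 _ hU hclq
  set D := U.filter fun x => Rich C (d j) k' (nbIn C U x) with hDdef
  have hDcard : d j ≤ D.card := hU
  have key : ∀ x, ∃ S, S ∈ insert ∅ (sparseFam C (d j) k' (nbIn C U x)) ∧ S ⊆ nbIn C U x ∧
      (x ∉ D → S = ∅) ∧ (x ∈ D → d j ≤ S.card ∧
        ((nbIn (C ∩ G) U x ∩ S).card : ℝ) ≤ d (j + 1)) := by
    intro x
    by_cases hx : x ∈ D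
    · have hx' := Finset.mem_filter.1 hx
      obtain ⟨S, h1, h2, h3, h4⟩ := exists_mem_sparseFam C (d j) (d (j + 1)) k' (nbIn C U x)
        (nbIn (C ∩ G) U x)
        (fun y hy => mem_nbIn.2 ⟨(mem_nbIn.1 hy).1, (Finset.mem_inter.1 (mem_nbIn.1 hy).2).1⟩)
        hx'.2 (hstuck x hx'.1 hx'.2)
      exact ⟨S, Finset.mem_insert_of_mem h1, h2, fun h => absurd hx h, fun _ => ⟨h3, h4.le⟩⟩
    · exact ⟨∅, Finset.mem_insert_self _ _, by simp, fun _ => rfl, fun h => absurd h hx⟩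
  choose S hS1 hS2 hS3 hS4 using key
  have hRC : starEdges S ⊆ C := by
    intro e
    induction e using Sym2.ind with
    | _ a b =>
      rw [mem_starEdges]
      rintro (h | h)
      · exact (mem_nbIn.1 (hS2 _ h)).2
      · rw [Sym2.eq_swap]; exact (mem_nbIn.1 (hS2 _ h)).2
  have hsum : ∑ x ∈ D, (S x).card ≤ 2 * (starEdges S).card := by
    rw [← card_ordered_pairs _ fun e he => hC e (hRC he), ← Finset.card_sigma]
    refine Finset.card_le_card_of_injOn (fun p => (p.1, p.2)) ?_ ?_
    · intro p hp
      have hp := Finset.mem_sigma.1 hp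
      simp [mem_starEdges, hp.2]
    · rintro ⟨a, b⟩ _ ⟨a', b'⟩ _ h
      simpa using h
  have hsum' : (∑ x ∈ D, ((S x).card : ℝ)) ≤ 2 * (starEdges S).card := by exact_mod_cast hsum
  have hlow : (D.card : ℝ) * d j ≤ ∑ x ∈ D, ((S x).card : ℝ) := by
    rw [← nsmul_eq_mul]
    exact Finset.card_nsmul_le_sum _ _ _ fun x hx => (hS4 x hx).1
  have hup : ((G ∩ starEdges S).card : ℝ) ≤ D.card * d (j + 1) := by
    have h1 : G ∩ starEdges S ⊆
        D.biUnion fun x => (nbIn (C ∩ G) U x ∩ S x).image fun y => s(x, y) := by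
      have aux : ∀ a b, s(a, b) ∈ G → b ∈ S a → a ∈ D ∧ b ∈ nbIn (C ∩ G) U a ∩ S a := by
        intro a b hab h
        have haD : a ∈ D := by
          by_contra hD
          rw [hS3 a hD] at h
          simp at h
        have := mem_nbIn.1 (hS2 _ h)
        exact ⟨haD, Finset.mem_inter.2 ⟨mem_nbIn.2 ⟨this.1, Finset.mem_inter.2 ⟨this.2, hab⟩⟩, h⟩⟩
      intro e
      induction e using Sym2.ind with
      | _ a b =>
        intro h
        rw [Finset.mem_inter, mem_starEdges] at h
        rw [Finset.mem_biUnion]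
        rcases h with ⟨hG', h | h⟩
        · exact ⟨a, (aux a b hG' h).1, Finset.mem_image.2 ⟨b, (aux a b hG' h).2, rfl⟩⟩
        · rw [Sym2.eq_swap] at hG' ⊢
          exact ⟨b, (aux b a hG' h).1, Finset.mem_image.2 ⟨a, (aux b a hG' h).2, rfl⟩⟩
    have h2 : (G ∩ starEdges S).card ≤ ∑ x ∈ D, (nbIn (C ∩ G) U x ∩ S x).card :=
      (Finset.card_le_card h1).trans (Finset.card_biUnion_le.trans
        (Finset.sum_le_sum fun x _ => Finset.card_image_le))
    calc ((G ∩ starEdges S).card : ℝ) ≤ ∑ x ∈ D, ((nbIn (C ∩ G) U x ∩ S x).card : ℝ) := by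
          exact_mod_cast h2
      _ ≤ D.card • d (j + 1) := Finset.sum_le_card_nsmul _ _ _ fun x hx => (hS4 x hx).2
      _ = _ := nsmul_eq_mul _ _
  refine ⟨starEdges S, ?_, hRC, ?_, ?_⟩
  · simp only [edgeFam, Finset.mem_biUnion, Finset.mem_range, Finset.mem_univ, true_and,
      Finset.mem_image, Fintype.mem_piFinset]
    refine ⟨j, by omega, U, S, fun x => ?_, rfl⟩
    rw [show k - 1 - j = k' by omega]
    exact hS1 x
  · have h1 : d k ≤ d j := hanti (by omega)
    have := hd0 k
    have := hd0 j
    nlinarith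
  · rw [hd] at hup
    have := mul_le_mul_of_nonneg_left (hlow.trans hsum') hτ
    linarith

end Containers

section Counting

variable {V : Type*} [Fintype V] [DecidableEq V]

/-- The ordered-pair weight comparing the edges of `C` and its monochromatic edges with the
complete multipartite graph of the colouring `c`. -/
noncomputable def pairWeight (C : Finset (Sym2 V)) (c : V → ℕ) (x y : V) : ℝ :=
  (if s(x, y) ∈ C then (if c x = c y then 2 else 1) else 0) - if c x = c y then 0 else 1

lemma sum_indicator_eq_card_nbIn (C : Finset (Sym2 V)) (U : Finset V) (x : V) :
    ∑ y ∈ U, (if s(x, y) ∈ C then (1 : ℝ) else 0) = (nbIn C U x).card := by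
  simp [nbIn]

lemma sum_card_nbIn_le (C : Finset (Sym2 V)) (U W E : Finset V) (d b : ℝ) (hb : 0 ≤ b)
    (hE : (E.card : ℝ) ≤ d) (h : ∀ x ∈ W, x ∉ E → ((nbIn C U x).card : ℝ) ≤ b) :
    ∑ x ∈ W, ((nbIn C U x).card : ℝ) ≤ W.card * b + d * Fintype.card V := by
  calc ∑ x ∈ W, ((nbIn C U x).card : ℝ)
      ≤ ∑ x ∈ W, (b + if x ∈ E then (Fintype.card V : ℝ) else 0) := by
        refine Finset.sum_le_sum fun x hx => ?_
        by_cases hxE : x ∈ E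
        · simp only [hxE, if_true]
          have : ((nbIn C U x).card : ℝ) ≤ Fintype.card V := by
            exact_mod_cast Finset.card_le_univ _
          linarith
        · simpa [hxE] using h x hx hxE
    _ = W.card * b + ((W ∩ E).card : ℝ) * Fintype.card V := by
        rw [Finset.sum_add_distrib, Finset.sum_const, nsmul_eq_mul, ← Finset.sum_filter,
          Finset.sum_const, nsmul_eq_mul, Finset.filter_mem_eq_inter]
    _ ≤ _ := by
        have : ((W ∩ E).card : ℝ) ≤ d :=
          le_trans (by exact_mod_cast Finset.card_le_card Finset.inter_subset_right) hE
        gcongr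

lemma sum_pairWeight_const (C : Finset (Sym2 V)) (U : Finset V) :
    ∑ x ∈ U, ∑ y ∈ U, pairWeight C (fun _ => 0) x y = 2 * ∑ x ∈ U, ((nbIn C U x).card : ℝ) := by
  simp_rw [← sum_indicator_eq_card_nbIn, Finset.mul_sum]
  refine Finset.sum_congr rfl fun x _ => Finset.sum_congr rfl fun y _ => ?_
  simp [pairWeight]

/-- A robust form of Füredi's stability argument. -/
lemma exists_coloring_of_not_rich (C : Finset (Sym2 V)) (d : ℝ) (hd : 0 ≤ d) (k : ℕ)
    (U : Finset V) (hU : ¬ Rich C d (k + 2) U) :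
    ∃ c : V → ℕ, (∀ x, c x ≤ k) ∧
      ∑ x ∈ U, ∑ y ∈ U, pairWeight C c x y ≤ 2 * (k + 2) * d * Fintype.card V := by
  have hcard : ∀ W : Finset V, (W.card : ℝ) ≤ Fintype.card V := fun W => by
    exact_mod_cast Finset.card_le_univ _
  induction k generalizing U with
  | zero =>
    refine ⟨fun _ => 0, by simp, ?_⟩
    rw [sum_pairWeight_const]
    rw [Rich, not_le] at hU
    have h := sum_card_nbIn_le C U U _ d d hd hU.le (fun x hx hxE => by
      by_contra! hlt
      refine hxE (Finset.mem_filter.2 ⟨hx, ?_⟩)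
      have : ((nbIn C U x).filter fun y => Rich C d 0 (nbIn C (nbIn C U x) y)) = nbIn C U x :=
        Finset.filter_true_of_mem fun _ _ => trivial
      rw [Rich, this]
      exact hlt.le)
    have := mul_le_mul_of_nonneg_right (hcard U) hd
    push_cast
    nlinarith
  | succ k ih =>
    rw [Rich, not_le] at hU
    set E := U.filter fun x => Rich C d (k + 2) (nbIn C U x) with hE
    by_cases hne : (U \ E).Nonempty
    · obtain ⟨x₀, hx₀, hmax⟩ := Finset.exists_max_image (U \ E) (fun x => (nbIn C U x).card) hne
      rw [Finset.mem_sdiff] at hx₀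
      set P := nbIn C U x₀ with hP
      have hPU : P ⊆ U := nbIn_subset _ _ _
      obtain ⟨c, hc, hsum⟩ := ih P (fun h => hx₀.2 (Finset.mem_filter.2 ⟨hx₀.1, h⟩))
      refine ⟨fun x => if x ∈ P then c x else k + 1, fun x => ?_, ?_⟩
      · dsimp only
        split_ifs
        · exact (hc x).trans (by omega)
        · exact le_rfl
      set c' : V → ℕ := fun x => if x ∈ P then c x else k + 1
      set W := U \ P
      have hW : ∀ x ∈ W, c' x = k + 1 := fun x hx => if_neg (Finset.mem_sdiff.1 hx).2
      have hPc : ∀ x ∈ P, c' x = c x := fun x hx => if_pos hx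
      have hne' : ∀ x ∈ P, c' x ≠ k + 1 := fun x hx => by
        rw [hPc x hx]; have := hc x; omega
      have split : ∀ f : V → ℝ, ∑ x ∈ U, f x = ∑ x ∈ W, f x + ∑ x ∈ P, f x := fun f =>
        (Finset.sum_sdiff hPU).symm
      have hWW : ∑ x ∈ W, ∑ y ∈ W, pairWeight C c' x y =
          2 * ∑ x ∈ W, ((nbIn C W x).card : ℝ) := by
        simp_rw [← sum_indicator_eq_card_nbIn, Finset.mul_sum]
        refine Finset.sum_congr rfl fun x hx => Finset.sum_congr rfl fun y hy => ?_
        simp [pairWeight, hW x hx, hW y hy]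
      have hWP : ∑ x ∈ W, ∑ y ∈ P, pairWeight C c' x y =
          ∑ x ∈ W, ((nbIn C P x).card : ℝ) - W.card * P.card := by
        rw [← nsmul_eq_mul, ← Finset.sum_const, ← Finset.sum_sub_distrib]
        refine Finset.sum_congr rfl fun x hx => ?_
        rw [← sum_indicator_eq_card_nbIn, Finset.card_eq_sum_ones, Nat.cast_sum,
          ← Finset.sum_sub_distrib]
        refine Finset.sum_congr rfl fun y hy => ?_
        have : ¬ (k + 1 = c' y) := fun h => hne' y hy h.symm
        simp [pairWeight, hW x hx, this]
      have hPW : ∑ x ∈ P, ∑ y ∈ W, pairWeight C c' x y =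
          ∑ x ∈ W, ∑ y ∈ P, pairWeight C c' x y := by
        rw [Finset.sum_comm]
        refine Finset.sum_congr rfl fun x hx => Finset.sum_congr rfl fun y hy => ?_
        simp [pairWeight, Sym2.eq_swap (a := x) (b := y), eq_comm (a := c' x)]
      have hPP : ∑ x ∈ P, ∑ y ∈ P, pairWeight C c' x y =
          ∑ x ∈ P, ∑ y ∈ P, pairWeight C c x y := by
        refine Finset.sum_congr rfl fun x hx => Finset.sum_congr rfl fun y hy => ?_
        simp [pairWeight, hPc x hx, hPc y hy]
      have hdeg : ∑ x ∈ W, ((nbIn C U x).card : ℝ) =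
          ∑ x ∈ W, ((nbIn C W x).card : ℝ) + ∑ x ∈ W, ((nbIn C P x).card : ℝ) := by
        rw [← Finset.sum_add_distrib]
        refine Finset.sum_congr rfl fun x _ => ?_
        simp_rw [← sum_indicator_eq_card_nbIn]
        exact split _
      have hbound := sum_card_nbIn_le C U W E d P.card (by positivity) hU.le
        (fun x hx hxE => by
          exact_mod_cast hmax x (Finset.mem_sdiff.2 ⟨(Finset.mem_sdiff.1 hx).1, hxE⟩))
      have hfirst : ∑ x ∈ U, ∑ y ∈ U, pairWeight C c' x y =
          (∑ x ∈ W, ∑ y ∈ W, pairWeight C c' x y + ∑ x ∈ W, ∑ y ∈ P, pairWeight C c' x y) +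
          (∑ x ∈ P, ∑ y ∈ W, pairWeight C c' x y + ∑ x ∈ P, ∑ y ∈ P, pairWeight C c' x y) := by
        rw [split, ← Finset.sum_add_distrib, ← Finset.sum_add_distrib]
        congr 1 <;> exact Finset.sum_congr rfl fun x _ => split _
      rw [hfirst, hPW, hWW, hWP, hPP]
      push_cast
      nlinarith
    · have hUE : U ⊆ E := by
        rwa [Finset.not_nonempty_iff_eq_empty, Finset.sdiff_eq_empty_iff_subset] at hne
      refine ⟨fun _ => 0, by simp, ?_⟩
      rw [sum_pairWeight_const]
      have h := sum_card_nbIn_le C U U E d 0 le_rfl hU.le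
        (fun x hx hxE => absurd (hUE hx) hxE)
      have : 0 ≤ ((k : ℝ) + 2) * (d * Fintype.card V) := by positivity
      push_cast
      nlinarith

/-- The number of edges of `G` that are monochromatic under `c`. -/
noncomputable def monoCard {κ : Type*} [DecidableEq κ] (G : Finset (Sym2 V)) (c : V → κ) : ℕ :=
  (G.filter fun e => (e.map c).IsDiag).card

/-- The number of ordered pairs that are bichromatic under `c`. -/
noncomputable def crossCard {κ : Type*} [DecidableEq κ] (c : V → κ) : ℕ :=
  (Finset.univ.filter fun p : V × V => c p.1 ≠ c p.2).card

lemma sum_pairWeight_univ (C : Finset (Sym2 V)) (hC : ∀ e ∈ C, ¬ e.IsDiag) (c : V → ℕ) :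
    ∑ x, ∑ y, pairWeight C c x y = 2 * C.card + 2 * monoCard C c - crossCard c := by
  have h1 := card_ordered_pairs C hC
  have h2 : (Finset.univ.filter fun p : V × V => s(p.1, p.2) ∈ C ∧ c p.1 = c p.2).card =
      2 * monoCard C c := by
    rw [monoCard, ← card_ordered_pairs _ fun e he => hC e (Finset.mem_filter.1 he).1]
    congr 1
    ext p
    simp
  have e1 : (2 * C.card : ℝ) = ∑ p : V × V, if s(p.1, p.2) ∈ C then (1 : ℝ) else 0 := by
    rw [Finset.sum_boole]; exact_mod_cast h1.symm
  have e2 : (2 * monoCard C c : ℝ) =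
      ∑ p : V × V, if s(p.1, p.2) ∈ C ∧ c p.1 = c p.2 then (1 : ℝ) else 0 := by
    rw [Finset.sum_boole]; exact_mod_cast h2.symm
  have e3 : (crossCard c : ℝ) =
      ∑ p : V × V, if c p.1 ≠ c p.2 then (1 : ℝ) else 0 := by
    rw [Finset.sum_boole, crossCard]
  rw [e1, e2, e3, ← Finset.sum_add_distrib, ← Finset.sum_sub_distrib, Fintype.sum_prod_type]
  refine Finset.sum_congr rfl fun x _ => Finset.sum_congr rfl fun y _ => ?_
  by_cases h : s(x, y) ∈ C <;> by_cases h' : c x = c y <;> simp [pairWeight, h, h']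
  norm_num

lemma card_add_monoCard_le_of_not_rich (C : Finset (Sym2 V)) (hC : ∀ e ∈ C, ¬ e.IsDiag) (d : ℝ)
    (hd : 0 ≤ d) (k : ℕ) (hU : ¬ Rich C d (k + 2) Finset.univ) :
    ∃ c : V → ℕ, (∀ x, c x ≤ k) ∧
      2 * (C.card : ℝ) + 2 * monoCard C c ≤ crossCard c + 2 * (k + 2) * d * Fintype.card V := by
  obtain ⟨c, hc, h⟩ := exists_coloring_of_not_rich C d hd k _ hU
  rw [sum_pairWeight_univ C hC] at h
  exact ⟨c, hc, by linarith⟩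

lemma sum_powerset_two_pow_le (R : Finset (Sym2 V)) (L : ℝ) (hL : 1 ≤ L) :
    ∑ F ∈ R.powerset.filter (fun F => (F.card : ℝ) ≤ 2 / L * R.card), (2 : ℝ) ^ F.card ≤
      Real.exp ((2 * Real.log L + 2) / L * R.card) := by
  have hL0 : 0 < L := by linarith
  have hlog : 0 ≤ Real.log L := Real.log_nonneg hL
  have h1 : ∀ F ∈ R.powerset.filter (fun F => (F.card : ℝ) ≤ 2 / L * R.card),
      (2 : ℝ) ^ F.card ≤ Real.exp (2 * Real.log L / L * R.card) * (2 / L) ^ F.card := by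
    intro F hF
    have hF' := (Finset.mem_filter.1 hF).2
    have : L ^ F.card ≤ Real.exp (2 * Real.log L / L * R.card) := by
      rw [← Real.exp_log (pow_pos hL0 _), Real.exp_le_exp, Real.log_pow]
      calc F.card * Real.log L ≤ (2 / L * R.card) * Real.log L := by gcongr
        _ = _ := by ring
    calc (2 : ℝ) ^ F.card = L ^ F.card * (2 / L) ^ F.card := by
          rw [← mul_pow]; congr 1; field_simp
      _ ≤ _ := by gcongr
  refine (Finset.sum_le_sum h1).trans ?_
  rw [← Finset.mul_sum]
  have h2 : ∑ F ∈ R.powerset.filter (fun F => (F.card : ℝ) ≤ 2 / L * R.card), (2 / L) ^ F.card ≤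
      Real.exp (2 / L * R.card) := by
    calc _ ≤ ∑ F ∈ R.powerset, (2 / L) ^ F.card :=
          Finset.sum_le_sum_of_subset_of_nonneg (Finset.filter_subset _ _)
            fun _ _ _ => by positivity
      _ = (2 / L + 1) ^ R.card := by
          rw [← Finset.sum_pow_mul_eq_add_pow]; simp
      _ ≤ Real.exp (2 / L) ^ R.card := by
          gcongr; exact Real.add_one_le_exp _
      _ = _ := by rw [← Real.exp_nat_mul]; ring_nf
  calc _ ≤ Real.exp (2 * Real.log L / L * R.card) * Real.exp (2 / L * R.card) := by gcongr
    _ = _ := by rw [← Real.exp_add]; ring_nf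

lemma rich_or_small_count (𝒢 : Finset (Finset (Sym2 V))) (q : ℕ) (L t X : ℝ) (hL : 1 ≤ L)
    [Nonempty V]
    (hdiag : ∀ G ∈ 𝒢, ∀ e ∈ G, ¬ e.IsDiag)
    (hclq : ∀ G ∈ 𝒢, ¬ HasClique G (q + 2) Finset.univ)
    (hfar : ∀ G ∈ 𝒢, ∀ c : V → ℕ, (∀ x, c x ≤ q) → t ≤ monoCard G c)
    (hX : ∀ c : V → ℕ, (∀ x, c x ≤ q) → (crossCard c : ℝ) ≤ 2 * X)
    (hcode : ((q + 2 : ℕ) * (2 ^ Fintype.card V *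
      ((Fintype.card V + 1) ^ (q + 2)) ^ Fintype.card V) : ℝ) ≤
      Real.exp ((Fintype.card V / L ^ (q + 3)) ^ 2 / 2 / L))
    (C : Finset (Sym2 V)) (hC : ∀ e ∈ C, ¬ e.IsDiag) (F : Finset (Sym2 V)) :
    ((𝒢.filter fun G => G \ C = F).card : ℝ) ≤
      Real.exp (Real.log 2 * (X - t + (q + 2) * (Fintype.card V) ^ 2 / L + F.card) +
        (2 * Real.log L + 3) / L * C.card) := by
  have hL0 : 0 < L := by linarith
  have hlog : 0 ≤ Real.log L := Real.log_nonneg hL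
  set n := Fintype.card V with hn
  have hn0 : 0 < n := Fintype.card_pos
  set d : ℕ → ℝ := fun j => n / L ^ (j + 1) with hd
  have hd0 : ∀ j, 0 ≤ d j := fun j => by simp only [hd]; positivity
  induction hcC : C.card using Nat.strong_induction_on generalizing C F with
  | _ N ih =>
  by_cases hrich : Rich C (d 0) (q + 2) Finset.univ
  · -- pass to the graphs obtained by exposing a sparse edge set
    set 𝓡 := (edgeFam C d (q + 2)).filter fun R => R ⊆ C ∧ d (q + 2) ^ 2 ≤ 2 * (R.card : ℝ)
    have hdq : 0 < d (q + 2) := by simp only [hd]; positivity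
    have hcover : 𝒢.filter (fun G => G \ C = F) ⊆ 𝓡.biUnion fun R =>
        (R.powerset.filter fun F' => (F'.card : ℝ) ≤ 2 / L * R.card).biUnion fun F' =>
          𝒢.filter fun G => G \ (C \ R) = F ∪ F' := by
      intro G hG
      obtain ⟨hG, hGF⟩ := Finset.mem_filter.1 hG
      obtain ⟨R, hR, hRC, hR2, hGR⟩ := exists_mem_edgeFam C G hC (hdiag G hG) d (1 / L)
        (by positivity) hd0 (fun j => by simp only [hd]; rw [pow_succ L (j + 1)]; field_simp)
        (fun i j hij => by simp only [hd]; gcongr) (q + 2) hrich (hclq G hG)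
      simp only [Finset.mem_biUnion, Finset.mem_filter, Finset.mem_powerset]
      refine ⟨R, Finset.mem_filter.2 ⟨hR, hRC, hR2⟩, G ∩ R, ⟨Finset.inter_subset_right, ?_⟩, hG, ?_⟩
      · convert hGR using 2; ring
      · rw [← hGF]
        ext e
        have := @hRC e
        simp only [Finset.mem_sdiff, Finset.mem_union, Finset.mem_inter]
        tauto
    set a := Real.log 2 * (X - t + (q + 2) * (n : ℝ) ^ 2 / L + F.card) with ha
    set θ := (2 * Real.log L + 3) / L with hθ
    have hθ0 : 0 ≤ θ := by positivity
    set B := Real.exp (-(d (q + 2) ^ 2 / 2 / L)) * Real.exp (a + θ * N) with hB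
    have hone : ∀ R ∈ 𝓡, ((((R.powerset.filter fun F' => (F'.card : ℝ) ≤ 2 / L * R.card).biUnion
        fun F' => 𝒢.filter fun G => G \ (C \ R) = F ∪ F').card : ℕ) : ℝ) ≤ B := by
      intro R hR
      obtain ⟨-, hRC, hR2⟩ := Finset.mem_filter.1 hR
      have hRpos : 0 < R.card := by
        have : (0 : ℝ) < R.card := by nlinarith [pow_pos hdq 2]
        exact_mod_cast this
      have hcard : (C \ R).card = C.card - R.card := Finset.card_sdiff_of_subset hRC
      have hle := Finset.card_le_card hRC
      have hcard' : ((C \ R).card : ℝ) = N - R.card := by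
        rw [hcard, Nat.cast_sub hle, hcC]
      calc _ ≤ ∑ F' ∈ R.powerset.filter (fun F' => (F'.card : ℝ) ≤ 2 / L * R.card),
            ((𝒢.filter fun G => G \ (C \ R) = F ∪ F').card : ℝ) := by
            exact_mod_cast Finset.card_biUnion_le
        _ ≤ ∑ F' ∈ R.powerset.filter (fun F' => (F'.card : ℝ) ≤ 2 / L * R.card),
            Real.exp (a + θ * (N - R.card)) * 2 ^ F'.card := by
            refine Finset.sum_le_sum fun F' _ => ?_
            refine (ih (C \ R).card (by omega) (C \ R)
              (fun e he => hC e (Finset.sdiff_subset he)) (F ∪ F') rfl).trans ?_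
            have h2 : (2 : ℝ) ^ F'.card = Real.exp (Real.log 2 * F'.card) := by
              rw [mul_comm, Real.exp_nat_mul, Real.exp_log two_pos]
            rw [h2, ← Real.exp_add, hcard', Real.exp_le_exp]
            have h3 : ((F ∪ F').card : ℝ) ≤ F.card + F'.card := by
              exact_mod_cast Finset.card_union_le _ _
            have := mul_le_mul_of_nonneg_left h3 (Real.log_nonneg one_le_two)
            rw [ha]
            linarith
        _ ≤ Real.exp (a + θ * (N - R.card)) * Real.exp ((2 * Real.log L + 2) / L * R.card) := by
            rw [← Finset.mul_sum]
            gcongr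
            exact sum_powerset_two_pow_le R L hL
        _ ≤ B := by
            rw [hB, ← Real.exp_add, ← Real.exp_add, Real.exp_le_exp, hθ]
            have : d (q + 2) ^ 2 / 2 / L ≤ R.card / L := by gcongr; linarith
            have e : (2 * Real.log L + 3) / L * ((N : ℝ) - R.card) + (2 * Real.log L + 2) / L * R.card
              = (2 * Real.log L + 3) / L * N - R.card / L := by ring
            linarith
    have hfam : (𝓡.card : ℝ) ≤ Real.exp (d (q + 2) ^ 2 / 2 / L) := by
      refine le_trans ?_ hcode
      have : 𝓡.card ≤ _ :=
        (Finset.card_le_card (Finset.filter_subset _ _)).trans (card_edgeFam_le C d (q + 2))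
      exact_mod_cast this
    calc ((𝒢.filter fun G => G \ C = F).card : ℝ) ≤ ∑ R ∈ 𝓡, B := by
          refine le_trans ?_ (Finset.sum_le_sum hone)
          exact_mod_cast (Finset.card_le_card hcover).trans Finset.card_biUnion_le
      _ = 𝓡.card * B := by rw [Finset.sum_const, nsmul_eq_mul]
      _ ≤ Real.exp (d (q + 2) ^ 2 / 2 / L) * B := by gcongr
      _ = _ := by rw [hB, ← mul_assoc, ← Real.exp_add]; simp
  · obtain ⟨c, hc, hcard⟩ := card_add_monoCard_le_of_not_rich C hC (d 0) (hd0 0) q hrich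
    rcases (𝒢.filter fun G => G \ C = F).eq_empty_or_nonempty with h0 | ⟨G, hG⟩
    · rw [h0]; simp; positivity
    obtain ⟨hG, hGF⟩ := Finset.mem_filter.1 hG
    have hcnt : (𝒢.filter fun G => G \ C = F).card ≤ 2 ^ C.card := by
      rw [← Finset.card_powerset]
      refine Finset.card_le_card_of_injOn (fun G => G ∩ C)
        (fun G _ => by simp) ?_
      intro G₁ h₁ G₂ h₂ h
      have h₁ := (Finset.mem_filter.1 h₁).2
      have h₂ := (Finset.mem_filter.1 h₂).2
      simp only at h
      rw [← Finset.sdiff_union_inter G₁ C, ← Finset.sdiff_union_inter G₂ C, h₁, h₂, h]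
    have hmono : t ≤ monoCard C c + F.card := by
      refine (hfar G hG c hc).trans ?_
      have : monoCard G c ≤ monoCard C c + F.card := by
        rw [monoCard, monoCard, ← hGF]
        refine le_trans (Finset.card_le_card ?_) (Finset.card_union_le _ _)
        intro e he
        simp only [Finset.mem_union, Finset.mem_filter, Finset.mem_sdiff] at he ⊢
        tauto
      exact_mod_cast this
    have hx := hX c hc
    have hd0' : d 0 = n / L := by simp [hd]
    have hNle : (N : ℝ) ≤ X - t + (q + 2) * (n : ℝ) ^ 2 / L + F.card := by
      rw [hd0', hcC] at hcard
      have e : 2 * ((q : ℝ) + 2) * (n / L) * n = 2 * ((q + 2) * (n : ℝ) ^ 2 / L) := by ring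
      rw [e] at hcard
      linarith
    calc ((𝒢.filter fun G => G \ C = F).card : ℝ) ≤ 2 ^ N := by
          rw [← hcC]; exact_mod_cast hcnt
      _ = Real.exp (Real.log 2 * N) := by
          rw [mul_comm, Real.exp_nat_mul, Real.exp_log two_pos]
      _ ≤ _ := by
          rw [Real.exp_le_exp]
          have h1 := mul_le_mul_of_nonneg_left hNle (Real.log_nonneg one_le_two)
          have : 0 ≤ (2 * Real.log L + 3) / L * N := by positivity
          linarith

/-- The number of graphs on `V` without cliques of size `q + 2` all of whose `(q + 1)`-colourings
have at least `t` monochromatic edges. -/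
theorem card_far_cliqueFree_le [Nonempty V] (𝒢 : Finset (Finset (Sym2 V))) (q : ℕ) (L t X : ℝ)
    (hL : 1 ≤ L)
    (hdiag : ∀ G ∈ 𝒢, ∀ e ∈ G, ¬ e.IsDiag)
    (hclq : ∀ G ∈ 𝒢, ¬ HasClique G (q + 2) Finset.univ)
    (hfar : ∀ G ∈ 𝒢, ∀ c : V → ℕ, (∀ x, c x ≤ q) → t ≤ monoCard G c)
    (hX : ∀ c : V → ℕ, (∀ x, c x ≤ q) → (crossCard c : ℝ) ≤ 2 * X)
    (hcode : ((q + 2 : ℕ) * (2 ^ Fintype.card V *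
      ((Fintype.card V + 1) ^ (q + 2)) ^ Fintype.card V) : ℝ) ≤
      Real.exp ((Fintype.card V / L ^ (q + 3)) ^ 2 / 2 / L)) :
    (𝒢.card : ℝ) ≤ Real.exp (Real.log 2 * (X - t) +
      (q + 5 + 2 * Real.log L) * (Fintype.card V) ^ 2 / L) := by
  have hL0 : 0 < L := by linarith
  have hlog : 0 ≤ Real.log L := Real.log_nonneg hL
  set C : Finset (Sym2 V) := Finset.univ.filter fun e => ¬ e.IsDiag with hC
  have h := rich_or_small_count 𝒢 q L t X hL hdiag hclq hfar hX hcode C (by simp [hC]) ∅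
  rw [Finset.filter_true_of_mem (fun G hG => Finset.sdiff_eq_empty_iff_subset.2 fun e he => by
    simpa [hC] using hdiag G hG e he)] at h
  refine h.trans ?_
  rw [Real.exp_le_exp]
  have hcard : (C.card : ℝ) ≤ (Fintype.card V : ℝ) ^ 2 := by
    have h1 := card_ordered_pairs C (by simp [hC])
    have h2 := Finset.card_le_univ (Finset.univ.filter fun p : V × V => s(p.1, p.2) ∈ C)
    rw [Fintype.card_prod] at h2
    have : C.card ≤ Fintype.card V ^ 2 := by rw [sq]; omega
    exact_mod_cast this
  have hl2 : Real.log 2 ≤ 1 := by have := Real.log_two_lt_d9; linarith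
  have h1 : Real.log 2 * ((q + 2) * (Fintype.card V : ℝ) ^ 2 / L) ≤
      1 * ((q + 2) * (Fintype.card V : ℝ) ^ 2 / L) := by gcongr
  have h2 : (2 * Real.log L + 3) / L * C.card ≤
      (2 * Real.log L + 3) / L * (Fintype.card V : ℝ) ^ 2 := by gcongr
  have e : ((q : ℝ) + 5 + 2 * Real.log L) * (Fintype.card V : ℝ) ^ 2 / L =
    1 * ((q + 2) * (Fintype.card V : ℝ) ^ 2 / L) +
      (2 * Real.log L + 3) / L * (Fintype.card V : ℝ) ^ 2 := by ring
  rw [e]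
  simp only [Finset.card_empty, Nat.cast_zero, add_zero]
  linarith

end Counting

section CrossPairs

variable {V : Type*} [Fintype V] [DecidableEq V]

/-- The pairs that are bichromatic under `c`. -/
noncomputable def crossSet {κ : Type*} [DecidableEq κ] (c : V → κ) : Finset (Sym2 V) :=
  Finset.univ.filter fun e => ¬ (e.map c).IsDiag

lemma mk_mem_crossSet {κ : Type*} [DecidableEq κ] {c : V → κ} {x y : V} :
    s(x, y) ∈ crossSet c ↔ c x ≠ c y := by
  simp [crossSet]

lemma not_isDiag_of_mem_crossSet {κ : Type*} [DecidableEq κ] {c : V → κ} {e : Sym2 V}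
    (he : e ∈ crossSet c) : ¬ e.IsDiag := by
  induction e using Sym2.ind with
  | _ x y =>
    rw [mk_mem_crossSet] at he
    simp only [Sym2.mk_isDiag_iff]
    rintro rfl
    exact he rfl

lemma two_mul_card_crossSet {κ : Type*} [DecidableEq κ] (c : V → κ) :
    2 * (crossSet c).card = crossCard c := by
  rw [← card_ordered_pairs _ fun e he => not_isDiag_of_mem_crossSet he, crossCard]
  simp only [mk_mem_crossSet]

/-- The Cauchy-Schwarz bound behind Turán's theorem. -/
lemma crossCard_eq {κ : Type*} [DecidableEq κ] [Fintype κ] (c : V → κ) :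
    (crossCard c : ℝ) = (Fintype.card V : ℝ) ^ 2 -
      ∑ i, ((Finset.univ.filter fun x => c x = i).card : ℝ) ^ 2 := by
  have h : crossCard c + (Finset.univ.filter fun p : V × V => c p.1 = c p.2).card =
      Fintype.card V ^ 2 := by
    rw [crossCard, add_comm, Finset.card_filter_add_card_filter_not, Finset.card_univ,
      Fintype.card_prod, sq]
  have h2 : (Finset.univ.filter fun p : V × V => c p.1 = c p.2).card =
      ∑ i, (Finset.univ.filter fun x => c x = i).card ^ 2 := by
    rw [Finset.card_eq_sum_card_fiberwise (f := fun p => c p.1) (t := Finset.univ) (by simp)]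
    refine Finset.sum_congr rfl fun i _ => ?_
    rw [sq, ← Finset.card_product]
    congr 1
    ext ⟨x, y⟩
    simp
    constructor
    · rintro ⟨h, rfl⟩; exact ⟨rfl, h.symm⟩
    · rintro ⟨rfl, h⟩; exact ⟨h.symm, rfl⟩
  rw [h2] at h
  have : ((crossCard c + ∑ i, (Finset.univ.filter fun x => c x = i).card ^ 2 : ℕ) : ℝ) =
    (Fintype.card V ^ 2 : ℕ) := by rw [h]
  push_cast at this
  linarith

lemma sum_card_fiber {κ : Type*} [DecidableEq κ] [Fintype κ] (c : V → κ) :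
    ∑ i, ((Finset.univ.filter fun x => c x = i).card : ℝ) = Fintype.card V := by
  rw [← Nat.cast_sum, ← Finset.card_eq_sum_card_fiberwise (f := c) (by simp)]
  simp

lemma crossCard_le_nat (c : V → ℕ) (q : ℕ) (hc : ∀ x, c x ≤ q) :
    (crossCard c : ℝ) * (q + 1) ≤ q * (Fintype.card V : ℝ) ^ 2 := by
  let f : V → Fin (q + 1) := fun x => ⟨c x, Nat.lt_succ_of_le (hc x)⟩
  have h1 : crossCard c = crossCard f := by
    simp [crossCard, f]
  rw [h1, crossCard_eq]
  have h3 := sq_sum_le_card_mul_sum_sq (s := (Finset.univ : Finset (Fin (q + 1))))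
    (f := fun i => ((Finset.univ.filter fun x => f x = i).card : ℝ))
  rw [sum_card_fiber] at h3
  simp only [Finset.card_univ, Fintype.card_fin] at h3
  push_cast at h3
  nlinarith

/-- A convenient sufficient condition for the coding estimate in `card_far_cliqueFree_le`. -/
lemma coding_bound (n k : ℕ) (L : ℝ) (hL : 1 ≤ L) (hk : 1 ≤ k) (hn : 1 ≤ n)
    (h : 8 * k * L ^ (2 * k + 3) * Real.log (n + 1) ≤ n) :
    ((k : ℕ) * (2 ^ n * ((n + 1) ^ k) ^ n) : ℝ) ≤ Real.exp ((n / L ^ (k + 1)) ^ 2 / 2 / L) := by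
  have hL0 : 0 < L := by linarith
  have hk' : (1 : ℝ) ≤ k := by exact_mod_cast hk
  have hn' : (1 : ℝ) ≤ n := by exact_mod_cast hn
  have hlog2 : Real.log 2 ≤ Real.log (n + 1) := Real.log_le_log (by norm_num) (by linarith)
  have hl2 := Real.log_two_gt_d9
  set l := Real.log (n + 1) with hl
  have e1 : (k : ℝ) ≤ Real.exp k := by linarith [Real.add_one_le_exp (k : ℝ)]
  have e2 : (2 : ℝ) ^ n ≤ Real.exp (n * l) := by
    rw [← Real.exp_log (show (0 : ℝ) < 2 ^ n by positivity), Real.log_pow]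
    exact Real.exp_le_exp.2 (by gcongr)
  have e3 : (((n : ℝ) + 1) ^ k) ^ n = Real.exp (n * (k * l)) := by
    rw [Real.exp_nat_mul, Real.exp_nat_mul, hl, Real.exp_log (by positivity)]
  calc ((k : ℕ) * (2 ^ n * ((n + 1) ^ k) ^ n) : ℝ)
      ≤ Real.exp k * (Real.exp (n * l) * Real.exp (n * (k * l))) := by
        rw [e3]; gcongr
    _ = Real.exp (k + n * l + n * (k * l)) := by rw [← Real.exp_add, ← Real.exp_add]; ring_nf
    _ ≤ _ := by
      rw [Real.exp_le_exp]
      have hp : 0 < L ^ (2 * k + 3) := by positivity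
      have e4 : ((n : ℝ) / L ^ (k + 1)) ^ 2 / 2 / L = n ^ 2 / (2 * L ^ (2 * k + 3)) := by
        rw [div_pow, div_div, div_div]
        congr 1
        ring
      rw [e4, le_div_iff₀ (by positivity)]
      have hl0 : 0 ≤ l := by linarith
      have a1 : (k : ℝ) ≤ 2 * (n * (k * l)) := by
        have : 1 * (0.5 : ℝ) ≤ n * l := by gcongr; linarith
        nlinarith
      have a2 : (n : ℝ) * l ≤ n * (k * l) := by
        gcongr; nlinarith
      calc ((k : ℝ) + n * l + n * (k * l)) * (2 * L ^ (2 * k + 3))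
          ≤ (4 * (n * (k * l))) * (2 * L ^ (2 * k + 3)) := by gcongr; linarith
        _ = n * (8 * k * L ^ (2 * k + 3) * l) := by ring
        _ ≤ n * n := by gcongr
        _ = (n : ℝ) ^ 2 := by ring

end CrossPairs

section PullbackEdges

variable {V : Type*} [Fintype V] [DecidableEq V]

lemma card_le_pow_mul_card_image_inter {α : Type*} [DecidableEq α] (𝓗 : Finset (Finset α))
    (E D : Finset α) (hE : ∀ H ∈ 𝓗, H ⊆ E) (hD : D ⊆ E) :
    𝓗.card ≤ 2 ^ (E.card - D.card) * (𝓗.image fun H => H ∩ D).card := by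
  rw [← Finset.card_sdiff_of_subset hD, ← Finset.card_powerset, ← Finset.card_product]
  refine Finset.card_le_card_of_injOn (fun H => (H \ D, H ∩ D)) ?_ ?_
  · intro H hH
    simp only [Finset.coe_product, Set.mem_prod, Finset.mem_coe, Finset.mem_powerset]
    exact ⟨Finset.sdiff_subset_sdiff (hE H hH) subset_rfl, Finset.mem_image_of_mem _ hH⟩
  · intro H _ H' _ h
    simp only [Prod.mk.injEq] at h
    rw [← Finset.sdiff_union_inter H D, ← Finset.sdiff_union_inter H' D, h.1, h.2]

/-- The trace of an edge set on a vertex set. -/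
noncomputable def pullEdges (A : Finset V) (F : Finset (Sym2 V)) : Finset (Sym2 A) :=
  Finset.univ.filter fun e => e.map Subtype.val ∈ F

lemma mem_pullEdges {A : Finset V} {F : Finset (Sym2 V)} {e : Sym2 A} :
    e ∈ pullEdges A F ↔ e.map Subtype.val ∈ F := by
  simp [pullEdges]

lemma hasClique_of_pullEdges {A : Finset V} {F : Finset (Sym2 V)} {k : ℕ}
    (h : HasClique (pullEdges A F) k Finset.univ) : HasClique F k A := by
  obtain ⟨S, -, hS, hc⟩ := h
  refine ⟨S.map (Function.Embedding.subtype _), ?_, by simpa using hS, ?_⟩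
  · intro x hx
    obtain ⟨y, -, rfl⟩ := Finset.mem_map.1 hx
    exact y.2
  · intro x hx y hy hxy
    obtain ⟨x, hx', rfl⟩ := Finset.mem_map.1 hx
    obtain ⟨y, hy', rfl⟩ := Finset.mem_map.1 hy
    simpa [mem_pullEdges] using hc x hx' y hy' (by rintro rfl; exact hxy rfl)

lemma card_cliqueFree_on_le {κ : Type*} [DecidableEq κ] [Fintype κ] (P : V → κ) (I : Finset κ)
    (q s : ℕ) (A : Finset V) (hI : I.card = q + 2) (hA : ∀ x ∈ A, P x ∈ I)
    (hAi : ∀ i ∈ I, (A.filter fun x => P x = i).card = s) (hs : 1 ≤ s) (L : ℝ) (hL : 1 ≤ L)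
    (hη : (q + 5 + 2 * Real.log L) * ((q : ℝ) + 2) ^ 2 / L ≤ Real.log 2 / 4)
    (hcode : 8 * (q + 2) * L ^ (2 * (q + 2) + 3) * Real.log ((q + 2) * s + 1) ≤ (q + 2) * s) :
    (((crossSet P).powerset.filter fun H => ¬ HasClique H (q + 2) A).card : ℝ) ≤
      2 ^ (crossSet P).card * Real.exp (-(Real.log 2 / 4 * s ^ 2)) := by
  set 𝓗 := (crossSet P).powerset.filter fun H => ¬ HasClique H (q + 2) A with h𝓗
  let P' : A → κ := fun x => P x
  set D := (crossSet P').image (Sym2.map Subtype.val) with hDdef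
  have hinj : Function.Injective (Sym2.map (Subtype.val : A → V)) :=
    Sym2.map.injective Subtype.val_injective
  have hDc : D.card = (crossSet P').card := Finset.card_image_of_injective _ hinj
  have hDsub : D ⊆ crossSet P := by
    intro e he
    obtain ⟨e', he', rfl⟩ := Finset.mem_image.1 he
    induction e' using Sym2.ind with
    | _ x y => simpa [mk_mem_crossSet] using mk_mem_crossSet.1 he'
  have hfib : ∀ i, (Finset.univ.filter fun x : A => P' x = i).card =
      (A.filter fun x => P x = i).card := by
    intro i
    rw [← Finset.card_map (Function.Embedding.subtype _)]
    congr 1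
    ext x
    simp [P']
    tauto
  have hzero : ∀ i ∉ I, (A.filter fun x => P x = i).card = 0 := by
    intro i hi
    rw [Finset.card_eq_zero, Finset.filter_eq_empty_iff]
    rintro x hx rfl
    exact hi (hA x hx)
  have hsum : ∀ j : ℕ, j ≠ 0 → ∑ i, ((Finset.univ.filter fun x : A => P' x = i).card : ℝ) ^ j =
      (q + 2) * (s : ℝ) ^ j := by
    intro j hj
    rw [← Finset.sum_subset (Finset.subset_univ I)]
    · rw [Finset.sum_congr rfl fun i hi => by rw [hfib, hAi i hi], Finset.sum_const, hI]
      simp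
    · intro i _ hi
      rw [hfib, hzero i hi]
      simp [hj]
  have hcardA : (Fintype.card A : ℝ) = (q + 2) * s := by
    have := hsum 1 one_ne_zero
    simp only [pow_one] at this
    rw [← this, sum_card_fiber]
  have hDcard : 2 * (D.card : ℝ) = (q + 2) * (q + 1) * s ^ 2 := by
    have h1 := two_mul_card_crossSet P'
    have h2 := crossCard_eq P'
    rw [hsum 2 two_ne_zero, hcardA, ← h1] at h2
    rw [hDc]
    push_cast at h2
    linarith
  have hs' : (1 : ℝ) ≤ s := by exact_mod_cast hs
  have hne : Nonempty A := by
    rw [← Fintype.card_pos_iff]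
    have : (0 : ℝ) < Fintype.card A := by rw [hcardA]; positivity
    exact_mod_cast this
  have hcardA' : Fintype.card A = (q + 2) * s := by exact_mod_cast hcardA
  set 𝓕 := (𝓗.image fun H => H ∩ D).image (pullEdges A) with h𝓕
  have h𝓕c : 𝓕.card = (𝓗.image fun H => H ∩ D).card := by
    refine Finset.card_image_of_injOn ?_
    intro X hX Y hY hXY
    have key : ∀ X ∈ 𝓗.image fun H => H ∩ D, X = (pullEdges A X).image (Sym2.map Subtype.val) := by
      intro X hX
      ext e
      constructor
      · intro he
        obtain ⟨H, -, rfl⟩ := Finset.mem_image.1 hX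
        obtain ⟨e', he', rfl⟩ := Finset.mem_image.1 (Finset.mem_inter.1 he).2
        exact Finset.mem_image_of_mem _ (mem_pullEdges.2 he)
      · intro he
        obtain ⟨e', he', rfl⟩ := Finset.mem_image.1 he
        exact mem_pullEdges.1 he'
    rw [key X hX, key Y hY]
    exact congrArg _ hXY
  have hmem : ∀ F ∈ 𝓕, ∃ H ∈ 𝓗, F = pullEdges A (H ∩ D) := by
    intro F hF
    obtain ⟨X, hX, rfl⟩ := Finset.mem_image.1 hF
    obtain ⟨H, hH, rfl⟩ := Finset.mem_image.1 hX
    exact ⟨H, hH, rfl⟩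
  have hThm := card_far_cliqueFree_le 𝓕 q L 0
    (q / (2 * (q + 1)) * ((q + 2) * s) ^ 2) hL ?_ ?_ ?_ ?_ ?_
  · have h1 := card_le_pow_mul_card_image_inter 𝓗 (crossSet P) D
      (fun H hH => Finset.mem_powerset.1 (Finset.mem_filter.1 hH).1) hDsub
    rw [← h𝓕c] at h1
    have hDle := Finset.card_le_card hDsub
    have h2 : (2 : ℝ) ^ ((crossSet P).card - D.card) =
        2 ^ (crossSet P).card * Real.exp (-(Real.log 2 * D.card)) := by
      rw [pow_sub₀ _ two_ne_zero hDle, Real.exp_neg, mul_comm (Real.log 2),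
        Real.exp_nat_mul, Real.exp_log two_pos]
    have h3 : (𝓗.card : ℝ) ≤ 2 ^ ((crossSet P).card - D.card) * 𝓕.card := by exact_mod_cast h1
    refine h3.trans ((mul_le_mul_of_nonneg_left hThm (by positivity)).trans ?_)
    rw [h2, mul_assoc, ← Real.exp_add]
    gcongr
    rw [hcardA]
    have hq1 : (0 : ℝ) < q + 1 := by positivity
    have e1 : (D.card : ℝ) - q / (2 * (q + 1)) * ((q + 2) * s) ^ 2 =
        (q + 2) / (2 * (q + 1)) * s ^ 2 := by
      have : (D.card : ℝ) = (q + 2) * (q + 1) * s ^ 2 / 2 := by linarith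
      rw [this]
      field_simp
      ring
    have e2 : (1 / 2 : ℝ) ≤ (q + 2) / (2 * (q + 1)) := by
      rw [div_le_div_iff₀ (by norm_num) (by positivity)]; linarith
    have e3 : (1 / 2 : ℝ) * s ^ 2 ≤ (q + 2) / (2 * (q + 1)) * s ^ 2 := by gcongr
    have e4 : (q + 5 + 2 * Real.log L) * (((q : ℝ) + 2) * s) ^ 2 / L ≤
        Real.log 2 / 4 * s ^ 2 := by
      calc (q + 5 + 2 * Real.log L) * (((q : ℝ) + 2) * s) ^ 2 / L =
          ((q + 5 + 2 * Real.log L) * ((q : ℝ) + 2) ^ 2 / L) * s ^ 2 := by ring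
        _ ≤ _ := by gcongr
    have hl2 : 0 < Real.log 2 := Real.log_pos (by norm_num)
    nlinarith [mul_le_mul_of_nonneg_left e3 hl2.le, congrArg (fun z => Real.log 2 * z) e1]
  · intro F hF e he
    obtain ⟨H, hH, rfl⟩ := hmem F hF
    have := Finset.mem_inter.1 (mem_pullEdges.1 he)
    have := not_isDiag_of_mem_crossSet (hDsub this.2)
    induction e using Sym2.ind with
    | _ x y =>
      rw [Sym2.map_mk, Sym2.mk_isDiag_iff] at this
      rw [Sym2.mk_isDiag_iff]
      exact fun h => this (congrArg _ h)
  · intro F hF hcl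
    obtain ⟨H, hH, rfl⟩ := hmem F hF
    obtain ⟨S, hS, hSc, hSe⟩ := hasClique_of_pullEdges hcl
    exact (Finset.mem_filter.1 hH).2 ⟨S, hS, hSc, fun x hx y hy hxy =>
      (Finset.mem_inter.1 (hSe x hx y hy hxy)).1⟩
  · intro F _ c _
    positivity
  · intro c hc
    have h1 := crossCard_le_nat c q hc
    rw [hcardA] at h1
    have hq1 : (0 : ℝ) < q + 1 := by positivity
    rw [← le_div_iff₀ hq1] at h1
    refine h1.trans (le_of_eq ?_)
    field_simp
  · have h1 : 1 ≤ Fintype.card A := Fintype.card_pos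
    refine coding_bound (Fintype.card A) (q + 2) L hL (by omega) h1 ?_
    rw [hcardA]
    push_cast
    exact hcode

/-- Few graphs between the parts miss a clique on a large balanced set. -/
lemma card_missing_clique_le {κ : Type*} [DecidableEq κ] [Fintype κ] (P : V → κ)
    (q s : ℕ) (hs : 1 ≤ s) (L : ℝ) (hL : 1 ≤ L)
    (hη : (q + 5 + 2 * Real.log L) * ((q : ℝ) + 2) ^ 2 / L ≤ Real.log 2 / 4)
    (hcode : 8 * (q + 2) * L ^ (2 * (q + 2) + 3) * Real.log ((q + 2) * s + 1) ≤ (q + 2) * s)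
    (𝓗 : Finset (Finset (Sym2 V))) (h𝓗 : ∀ H ∈ 𝓗, H ⊆ crossSet P)
    (h : ∀ H ∈ 𝓗, ∃ I : Finset κ, I.card = q + 2 ∧ ∃ N : Finset V,
      (∀ i ∈ I, s ≤ (N.filter fun x => P x = i).card) ∧ ¬ HasClique H (q + 2) N) :
    (𝓗.card : ℝ) ≤ 2 ^ Fintype.card V *
      (2 ^ (crossSet P).card * Real.exp (-(Real.log 2 / 4 * s ^ 2))) := by
  let good : Finset V → Prop := fun A => ∃ I : Finset κ, I.card = q + 2 ∧ (∀ x ∈ A, P x ∈ I) ∧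
    ∀ i ∈ I, (A.filter fun x => P x = i).card = s
  have hcover : 𝓗 ⊆ (Finset.univ.filter good).biUnion fun A =>
      (crossSet P).powerset.filter fun H => ¬ HasClique H (q + 2) A := by
    intro H hH
    obtain ⟨I, hI, N, hN, hcl⟩ := h H hH
    choose! T hT hTc using fun i (hi : i ∈ I) => Finset.exists_subset_card_eq (hN i hi)
    have hTP : ∀ i ∈ I, ∀ x ∈ T i, x ∈ N ∧ P x = i := fun i hi x hx =>
      Finset.mem_filter.1 (hT i hi hx)
    refine Finset.mem_biUnion.2 ⟨I.biUnion T, Finset.mem_filter.2 ⟨Finset.mem_univ _, I, hI, ?_, ?_⟩,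
      Finset.mem_filter.2 ⟨Finset.mem_powerset.2 (h𝓗 H hH), ?_⟩⟩
    · intro x hx
      obtain ⟨i, hi, hx⟩ := Finset.mem_biUnion.1 hx
      rw [(hTP i hi x hx).2]
      exact hi
    · intro i hi
      rw [← hTc i hi]
      congr 1
      ext x
      simp only [Finset.mem_filter, Finset.mem_biUnion]
      constructor
      · rintro ⟨⟨j, hj, hx⟩, hxi⟩
        have := (hTP j hj x hx).2
        rw [← hxi, this]
        exact hx
      · intro hx
        exact ⟨⟨i, hi, hx⟩, (hTP i hi x hx).2⟩
    · rintro ⟨S, hS, hS2, hS3⟩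
      refine hcl ⟨S, hS.trans ?_, hS2, hS3⟩
      intro x hx
      obtain ⟨i, hi, hx⟩ := Finset.mem_biUnion.1 hx
      exact (hTP i hi x hx).1
  calc (𝓗.card : ℝ) ≤ ∑ A ∈ Finset.univ.filter good,
        (((crossSet P).powerset.filter fun H => ¬ HasClique H (q + 2) A).card : ℝ) := by
        exact_mod_cast (Finset.card_le_card hcover).trans Finset.card_biUnion_le
    _ ≤ ∑ A ∈ Finset.univ.filter good,
        (2 ^ (crossSet P).card * Real.exp (-(Real.log 2 / 4 * s ^ 2)) : ℝ) := by
        refine Finset.sum_le_sum fun A hA => ?_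
        obtain ⟨I, hI, hA1, hA2⟩ := (Finset.mem_filter.1 hA).2
        exact card_cliqueFree_on_le P I q s A hI hA1 hA2 hs L hL hη hcode
    _ ≤ _ := by
        rw [Finset.sum_const, nsmul_eq_mul]
        gcongr
        have := Finset.card_le_univ (Finset.univ.filter good)
        rw [Fintype.card_finset] at this
        exact_mod_cast this

end PullbackEdges

section Pairs

lemma sum_half_pow_pairs {α ι : Type*} [DecidableEq α] [DecidableEq ι] (I : Finset ι)
    (p q : ι → α) (E : Finset α) (hp : ∀ i ∈ I, p i ∈ E) (hq : ∀ i ∈ I, q i ∈ E)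
    (hpq : ∀ i ∈ I, ∀ j ∈ I, p i ≠ q j) (hpp : ∀ i ∈ I, ∀ j ∈ I, p i = p j → i = j)
    (hqq : ∀ i ∈ I, ∀ j ∈ I, q i = q j → i = j) :
    ∑ G ∈ E.powerset, (1 / 2 : ℝ) ^ (I.filter fun i => p i ∈ G ∧ q i ∈ G).card =
      2 ^ E.card * (7 / 8) ^ I.card := by
  induction I using Finset.induction_on generalizing E with
  | empty => simp
  | insert a I ha ih =>
    simp only [Finset.mem_insert, forall_eq_or_imp] at hp hq hpq hpp hqq
    set E' := (E.erase (p a)).erase (q a) with hE'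
    have hqE' : q a ∉ E' := by simp [hE']
    have hpE' : p a ∉ insert (q a) E' := by simp [hE', hpq.1.1]
    have hE : E = insert (p a) (insert (q a) E') := by
      rw [hE', Finset.insert_erase (by simp [hq.1, hpq.1.1.symm]), Finset.insert_erase hp.1]
    have hcard : E.card = E'.card + 2 := by
      rw [hE, Finset.card_insert_of_notMem hpE', Finset.card_insert_of_notMem hqE']
    have hne : ∀ i ∈ I, p i ≠ p a ∧ q i ≠ q a ∧ p i ≠ q a ∧ q i ≠ p a := by
      intro i hi
      refine ⟨fun h => ?_, fun h => ?_, (hpq.2 i hi).1, (hpq.1.2 i hi).symm⟩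
      · exact ha ((hpp.2 i hi).1 h ▸ hi)
      · exact ha ((hqq.2 i hi).1 h ▸ hi)
    have ih' := ih E' (fun i hi => by simp [hE', hp.2 i hi, (hne i hi).1, (hne i hi).2.2.1])
      (fun i hi => by simp [hE', hq.2 i hi, (hne i hi).2.1, (hne i hi).2.2.2])
      (fun i hi j hj => (hpq.2 i hi).2 j hj) (fun i hi j hj => (hpp.2 i hi).2 j hj)
      (fun i hi j hj => (hqq.2 i hi).2 j hj)
    rw [hcard, hE, Finset.sum_powerset_insert hpE', Finset.sum_powerset_insert hqE',
      Finset.sum_powerset_insert hqE', ← Finset.sum_add_distrib, ← Finset.sum_add_distrib,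
      ← Finset.sum_add_distrib, Finset.card_insert_of_notMem ha]
    rw [show (2 : ℝ) ^ (E'.card + 2) * (7 / 8) ^ (I.card + 1) =
      7 / 2 * (2 ^ E'.card * (7 / 8) ^ I.card) by ring, ← ih', Finset.mul_sum]
    refine Finset.sum_congr rfl fun G hG => ?_
    have hG := Finset.mem_powerset.1 hG
    have hpG : p a ∉ G := fun h => hpE' (Finset.mem_insert_of_mem (hG h))
    have hqG : q a ∉ G := fun h => hqE' (hG h)
    have hpa := hpq.1.1
    have h1 : ∀ X : Finset α, G ⊆ X → X ⊆ insert (p a) (insert (q a) G) →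
        (I.filter fun i => p i ∈ X ∧ q i ∈ X) = I.filter fun i => p i ∈ G ∧ q i ∈ G := by
      intro X h1 h2
      refine Finset.filter_congr fun i hi => ?_
      have key : ∀ z, z ≠ p a → z ≠ q a → (z ∈ X ↔ z ∈ G) := fun z hz hz' =>
        ⟨fun h => by simpa [hz, hz'] using h2 h, fun h => h1 h⟩
      rw [key _ (hne i hi).1 (hne i hi).2.2.1, key _ (hne i hi).2.2.2 (hne i hi).2.1]
    have s1 : G ⊆ insert (q a) G := Finset.subset_insert _ _
    have s2 : G ⊆ insert (p a) G := Finset.subset_insert _ _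
    rw [Finset.filter_insert, Finset.filter_insert, Finset.filter_insert, Finset.filter_insert,
      if_neg (by simp [hpG]), if_neg (by simp [hpG, hpa]), if_neg (by simp [hqG, hpa.symm]),
      if_pos (by simp), Finset.card_insert_of_notMem (by simp [ha]),
      h1 (insert (q a) G) s1 (Finset.subset_insert _ _),
      h1 (insert (p a) G) s2 (Finset.insert_subset_insert _ s1),
      h1 _ (s1.trans (Finset.subset_insert _ _)) subset_rfl]
    ring

lemma card_few_pairs_le {α ι : Type*} [DecidableEq α] [DecidableEq ι] (I : Finset ι)
    (p q : ι → α) (E : Finset α) (hp : ∀ i ∈ I, p i ∈ E) (hq : ∀ i ∈ I, q i ∈ E)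
    (hpq : ∀ i ∈ I, ∀ j ∈ I, p i ≠ q j) (hpp : ∀ i ∈ I, ∀ j ∈ I, p i = p j → i = j)
    (hqq : ∀ i ∈ I, ∀ j ∈ I, q i = q j → i = j) (S : ℕ) :
    ((E.powerset.filter fun G => (I.filter fun i => p i ∈ G ∧ q i ∈ G).card ≤ S).card : ℝ) ≤
      2 ^ E.card * (7 / 8) ^ I.card * 2 ^ S := by
  rw [← sum_half_pow_pairs I p q E hp hq hpq hpp hqq, ← div_le_iff₀ (by positivity)]
  calc _ = ∑ G ∈ E.powerset.filter fun G => (I.filter fun i => p i ∈ G ∧ q i ∈ G).card ≤ S,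
        (1 / 2 : ℝ) ^ S := by
        rw [Finset.sum_const, nsmul_eq_mul, one_div, inv_pow, div_eq_mul_inv]
    _ ≤ ∑ G ∈ E.powerset.filter fun G => (I.filter fun i => p i ∈ G ∧ q i ∈ G).card ≤ S,
        (1 / 2 : ℝ) ^ (I.filter fun i => p i ∈ G ∧ q i ∈ G).card := by
        refine Finset.sum_le_sum fun G hG => ?_
        exact pow_le_pow_of_le_one (by norm_num) (by norm_num) (Finset.mem_filter.1 hG).2
    _ ≤ _ := Finset.sum_le_sum_of_subset_of_nonneg (Finset.filter_subset _ _)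
        fun _ _ _ => by positivity

/-- The set of pairs in `M` is a matching. -/
def IsPairMatching {V : Type*} (M : Finset (V × V)) : Prop :=
  ∀ p ∈ M, ∀ p' ∈ M, p.1 ≠ p'.2 ∧ (p.1 = p'.1 → p = p') ∧ (p.2 = p'.2 → p = p')

variable {V : Type*} [Fintype V] [DecidableEq V]

/-- The vertices covered by a set of pairs. -/
def pairVerts (M : Finset (V × V)) : Finset V := M.image Prod.fst ∪ M.image Prod.snd

lemma card_pairVerts_le (M : Finset (V × V)) : (pairVerts M).card ≤ 2 * M.card := by
  have h1 := Finset.card_union_le (M.image Prod.fst) (M.image Prod.snd)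
  have h2 := Finset.card_image_le (s := M) (f := Prod.fst)
  have h3 := Finset.card_image_le (s := M) (f := Prod.snd)
  rw [pairVerts]
  omega

lemma exists_pairMatching (B : Finset (Sym2 V)) (hB : ∀ e ∈ B, ¬ e.IsDiag) (D : ℕ) (hD : 1 ≤ D)
    (hdeg : ∀ v, (nbIn B Finset.univ v).card ≤ D) (ν : ℕ) (hν : 2 * ν * D ≤ B.card) :
    ∃ M : Finset (V × V), M.card = ν ∧ IsPairMatching M ∧ ∀ p ∈ M, s(p.1, p.2) ∈ B := by
  induction ν with
  | zero => exact ⟨∅, by simp, by simp [IsPairMatching], by simp⟩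
  | succ ν ih =>
    obtain ⟨M, hM, hMm, hMB⟩ := ih (by nlinarith)
    set W := (pairVerts M).biUnion fun v => (nbIn B Finset.univ v).image fun w => s(v, w) with hW
    have hWc : W.card < B.card := by
      have h1 : W.card ≤ (pairVerts M).card * D := Finset.card_biUnion_le_card_mul _ _ _ fun v _ =>
        Finset.card_image_le.trans (hdeg v)
      have h2 := card_pairVerts_le M
      rw [hM] at h2
      nlinarith
    obtain ⟨e, heB, heW⟩ := Finset.exists_mem_notMem_of_card_lt_card hWc
    induction e using Sym2.ind with
    | _ x y =>
      have hxy : x ≠ y := by simpa using hB _ heB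
      have hx : x ∉ pairVerts M := fun h => heW <| Finset.mem_biUnion.2
        ⟨x, h, Finset.mem_image.2 ⟨y, by simpa [mem_nbIn] using heB, rfl⟩⟩
      have hy : y ∉ pairVerts M := fun h => heW <| Finset.mem_biUnion.2
        ⟨y, h, Finset.mem_image.2 ⟨x, by simpa [mem_nbIn, Sym2.eq_swap] using heB, Sym2.eq_swap⟩⟩
      have hm : ∀ p ∈ M, p.1 ∈ pairVerts M ∧ p.2 ∈ pairVerts M := fun p hp =>
        ⟨Finset.mem_union_left _ (Finset.mem_image_of_mem _ hp),
          Finset.mem_union_right _ (Finset.mem_image_of_mem _ hp)⟩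
      have hne : ∀ p ∈ M, x ≠ p.1 ∧ x ≠ p.2 ∧ y ≠ p.1 ∧ y ≠ p.2 := fun p hp =>
        ⟨fun h => hx (h ▸ (hm p hp).1), fun h => hx (h ▸ (hm p hp).2),
          fun h => hy (h ▸ (hm p hp).1), fun h => hy (h ▸ (hm p hp).2)⟩
      refine ⟨insert (x, y) M, ?_, ?_, ?_⟩
      · rw [Finset.card_insert_of_notMem (fun h => hx (hm _ h).1), hM]
      · intro p hp p' hp'
        rcases Finset.mem_insert.1 hp with rfl | hp <;> rcases Finset.mem_insert.1 hp' with rfl | hp'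
        · exact ⟨hxy, fun _ => rfl, fun _ => rfl⟩
        · have := hne p' hp'
          exact ⟨this.2.1, fun h => absurd h this.1, fun h => absurd h this.2.2.2⟩
        · have := hne p hp
          exact ⟨this.2.2.1.symm, fun h => absurd h.symm this.1, fun h => absurd h.symm this.2.2.2⟩
        · exact hMm p hp p' hp'
      · intro p hp
        rcases Finset.mem_insert.1 hp with rfl | hp
        · exact heB
        · exact hMB p hp

/-- Few graphs between the parts have, for each pair of a matching inside the parts, only few
common neighbours of the pair in some other part. -/
lemma card_few_common_nbrs_le {κ : Type*} [DecidableEq κ] [Fintype κ] (P : V → κ)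
    (M : Finset (V × V)) (hM : IsPairMatching M) (hMP : ∀ p ∈ M, P p.1 = P p.2) (u s : ℕ)
    (hu : ∀ a, u ≤ (Finset.univ.filter fun w => P w = a ∧ w ∉ pairVerts M).card)
    (𝓗 : Finset (Finset (Sym2 V))) (h𝓗 : ∀ H ∈ 𝓗, H ⊆ crossSet P)
    (h : ∀ H ∈ 𝓗, ∀ p ∈ M, ∃ a, a ≠ P p.1 ∧ (Finset.univ.filter fun w =>
      (P w = a ∧ w ∉ pairVerts M) ∧ s(p.1, w) ∈ H ∧ s(p.2, w) ∈ H).card ≤ s) :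
    (𝓗.card : ℝ) ≤
      2 ^ (crossSet P).card * (Fintype.card κ * ((7 / 8) ^ u * 2 ^ s)) ^ M.card := by
  let I : (M → κ) → Finset (M × V) := fun a => Finset.univ.filter fun z =>
    P z.2 = a z.1 ∧ z.2 ∉ pairVerts M
  let pf : M × V → Sym2 V := fun z => s(z.1.1.1, z.2)
  let qf : M × V → Sym2 V := fun z => s(z.1.1.2, z.2)
  let T : Finset (M → κ) := Finset.univ.filter fun a => ∀ p : M, a p ≠ P p.1.1
  have hcover : 𝓗 ⊆ T.biUnion fun a => (crossSet P).powerset.filter fun G =>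
      ((I a).filter fun i => pf i ∈ G ∧ qf i ∈ G).card ≤ M.card * s := by
    intro H hH
    choose a ha ha' using fun p : M => h H hH p.1 p.2
    refine Finset.mem_biUnion.2 ⟨a, by simpa [T] using ha, Finset.mem_filter.2
      ⟨Finset.mem_powerset.2 (h𝓗 H hH), ?_⟩⟩
    rw [Finset.card_eq_sum_card_fiberwise (f := Prod.fst) (t := Finset.univ) (by simp)]
    refine (Finset.sum_le_card_nsmul _ _ s fun p _ => ?_).trans (by simp)
    refine le_trans (Finset.card_le_card_of_injOn Prod.snd ?_ ?_) (ha' p)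
    · rintro ⟨p', w⟩ hw
      simp [I, pf, qf] at hw ⊢
      obtain ⟨h1, rfl⟩ := hw
      exact h1
    · rintro ⟨p', w⟩ hw ⟨p'', w'⟩ hw' hww
      have h1 := (Finset.mem_filter.1 hw).2
      have h2 := (Finset.mem_filter.1 hw').2
      exact Prod.ext (h1.trans h2.symm) hww
  have hIcard : ∀ a, M.card * u ≤ (I a).card := by
    intro a
    rw [Finset.card_eq_sum_card_fiberwise (s := I a) (f := Prod.fst) (t := Finset.univ) (by simp)]
    have h1 : M.card * u = (Finset.univ : Finset M).card • u := by simp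
    rw [h1]
    refine Finset.card_nsmul_le_sum Finset.univ _ u fun p _ => ?_
    refine (hu (a p)).trans (Finset.card_le_card_of_injOn (fun w => (p, w)) ?_ ?_)
    · intro w hw
      simp [I] at hw ⊢
      exact hw
    · intro w _ w' _ h
      simpa using h
  have hverts : ∀ p ∈ M, ∀ w ∉ pairVerts M, w ≠ p.1 ∧ w ≠ p.2 := fun p hp w hw =>
    ⟨fun h => hw (h ▸ Finset.mem_union_left _ (Finset.mem_image_of_mem _ hp)),
      fun h => hw (h ▸ Finset.mem_union_right _ (Finset.mem_image_of_mem _ hp))⟩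
  have hone : ∀ a ∈ T, (((crossSet P).powerset.filter fun G =>
      ((I a).filter fun i => pf i ∈ G ∧ qf i ∈ G).card ≤ M.card * s).card : ℝ) ≤
      2 ^ (crossSet P).card * ((7 / 8) ^ u * 2 ^ s) ^ M.card := by
    intro a ha
    have haT : ∀ p : M, a p ≠ P p.1.1 := by simpa [T] using ha
    have hI : ∀ z ∈ I a, P z.2 = a z.1 ∧ z.2 ∉ pairVerts M := fun z hz => by simpa [I] using hz
    refine (card_few_pairs_le (I a) pf qf (crossSet P) ?_ ?_ ?_ ?_ ?_ (M.card * s)).trans ?_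
    · intro z hz
      rw [mk_mem_crossSet, (hI z hz).1]
      exact (haT z.1).symm
    · intro z hz
      rw [mk_mem_crossSet, (hI z hz).1, ← hMP _ z.1.2]
      exact (haT z.1).symm
    · rintro ⟨p, w⟩ hz ⟨p', w'⟩ hz' heq
      have h1 := hverts p.1 p.2 w' (hI _ hz').2
      simp only [pf, qf, Sym2.eq_iff] at heq
      rcases heq with ⟨h, -⟩ | ⟨h, -⟩
      · exact (hM p.1 p.2 p'.1 p'.2).1 h
      · exact h1.1 h.symm
    · rintro ⟨p, w⟩ hz ⟨p', w'⟩ hz' heq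
      have h1 := hverts p.1 p.2 w' (hI _ hz').2
      simp only [pf, Sym2.eq_iff] at heq
      rcases heq with ⟨h, rfl⟩ | ⟨h, -⟩
      · rw [Subtype.ext ((hM p.1 p.2 p'.1 p'.2).2.1 h)]
      · exact absurd h.symm h1.1
    · rintro ⟨p, w⟩ hz ⟨p', w'⟩ hz' heq
      have h1 := hverts p.1 p.2 w' (hI _ hz').2
      simp only [qf, Sym2.eq_iff] at heq
      rcases heq with ⟨h, rfl⟩ | ⟨h, -⟩
      · rw [Subtype.ext ((hM p.1 p.2 p'.1 p'.2).2.2 h)]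
      · exact absurd h.symm h1.2
    · rw [mul_pow, ← pow_mul, ← pow_mul, mul_assoc, mul_comm u, mul_comm s]
      gcongr ?_ * (?_ * ?_)
      exact pow_le_pow_of_le_one (by norm_num) (by norm_num) (hIcard a)
  calc (𝓗.card : ℝ) ≤ ∑ a ∈ T, _ := by
        exact_mod_cast (Finset.card_le_card hcover).trans Finset.card_biUnion_le
    _ ≤ ∑ a ∈ T, (2 ^ (crossSet P).card * ((7 / 8) ^ u * 2 ^ s) ^ M.card : ℝ) :=
        Finset.sum_le_sum hone
    _ ≤ _ := by
        have h1 := Finset.card_le_univ T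
        rw [Fintype.card_fun, Fintype.card_coe] at h1
        have h2 : (T.card : ℝ) ≤ (Fintype.card κ : ℝ) ^ M.card := by exact_mod_cast h1
        rw [Finset.sum_const, nsmul_eq_mul, mul_pow (Fintype.card κ : ℝ), mul_left_comm]
        gcongr

end Pairs

section Parts

variable {V : Type*} [Fintype V] [DecidableEq V]

lemma card_missing_clique_le_of_le {κ : Type*} [DecidableEq κ] [Fintype κ] (P : V → κ)
    (r k s : ℕ) (hk : 2 ≤ k) (hkr : k ≤ r) (hr : r ≤ Fintype.card V) (hs : s ≤ Fintype.card V)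
    (L : ℝ) (hL : 1 ≤ L) (hη : (r + 3 + 2 * Real.log L) * (r : ℝ) ^ 2 / L ≤ Real.log 2 / 4)
    (hcode : 16 * L ^ (2 * r + 3) * Real.log (Fintype.card V + 1) ≤ s)
    (𝓗 : Finset (Finset (Sym2 V))) (h𝓗 : ∀ H ∈ 𝓗, H ⊆ crossSet P)
    (h : ∀ H ∈ 𝓗, ∃ I : Finset κ, I.card = k ∧ ∃ N : Finset V,
      (∀ i ∈ I, s ≤ (N.filter fun x => P x = i).card) ∧ ¬ HasClique H k N) :
    (𝓗.card : ℝ) ≤ 2 ^ Fintype.card V *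
      (2 ^ (crossSet P).card * Real.exp (-(Real.log 2 / 4 * s ^ 2))) := by
  obtain ⟨q, rfl⟩ : ∃ q, k = q + 2 := ⟨k - 2, by omega⟩
  set m := Fintype.card V
  have hm : (2 : ℝ) ≤ m := by exact_mod_cast (by omega : 2 ≤ m)
  have hlm : 0 < Real.log (m + 1) := Real.log_pos (by linarith)
  have hlogL := Real.log_nonneg hL
  have hs1 : 1 ≤ s := by
    by_contra hs0
    obtain rfl : s = 0 := by omega
    have : 0 < 16 * L ^ (2 * r + 3) * Real.log (m + 1) := by positivity
    simp only [Nat.cast_zero] at hcode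
    linarith
  have hqr : (q : ℝ) + 2 ≤ r := by exact_mod_cast hkr
  refine card_missing_clique_le P q s hs1 L hL ?_ ?_ 𝓗 h𝓗 h
  · refine le_trans ?_ hη
    gcongr ?_ * ?_ ^ 2 / L
    linarith
  · have h1 : Real.log ((q + 2) * s + 1) ≤ 2 * Real.log (m + 1) := by
      have : 2 * Real.log ((m : ℝ) + 1) = Real.log (((m : ℝ) + 1) ^ 2) := by
        rw [Real.log_pow]; norm_num
      rw [this]
      apply Real.log_le_log (by positivity)
      have a1 : (s : ℝ) ≤ m := by exact_mod_cast hs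
      have a2 : (r : ℝ) ≤ m := by exact_mod_cast hr
      have : ((q : ℝ) + 2) * s ≤ m * m := by gcongr; linarith
      nlinarith
    have h2 : L ^ (2 * (q + 2) + 3) ≤ L ^ (2 * r + 3) := pow_le_pow_right₀ hL (by omega)
    calc 8 * ((q : ℝ) + 2) * L ^ (2 * (q + 2) + 3) * Real.log ((q + 2) * s + 1)
        ≤ 8 * ((q : ℝ) + 2) * L ^ (2 * r + 3) * (2 * Real.log (m + 1)) := by
          gcongr
          refine Real.log_nonneg ?_
          have : (0 : ℝ) ≤ (q + 2) * s := by positivity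
          linarith
      _ = (q + 2) * (16 * L ^ (2 * r + 3) * Real.log (m + 1)) := by ring
      _ ≤ _ := by gcongr

/-- Every vertex has at least as many neighbours in every other part as in its own. -/
def LocallyOptimal {κ : Type*} [DecidableEq κ] (G : Finset (Sym2 V)) (P : V → κ) : Prop :=
  ∀ v i, ((nbIn G Finset.univ v).filter fun w => P w = P v).card ≤
    ((nbIn G Finset.univ v).filter fun w => P w = i).card

lemma HasClique.insert {G H : Finset (Sym2 V)} {k : ℕ} {N : Finset V} (h : HasClique H k N)
    (hHG : H ⊆ G) (v : V) (hN : ∀ w ∈ N, s(v, w) ∈ G) (hv : s(v, v) ∉ G) :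
    HasClique G (k + 1) (insert v N) := by
  obtain ⟨S, hS, hSc, hSe⟩ := h
  have hvS : v ∉ S := fun hvS => hv (hN v (hS hvS))
  refine ⟨Insert.insert v S, Finset.insert_subset_insert _ hS, by
    rw [Finset.card_insert_of_notMem hvS, hSc], ?_⟩
  intro x hx y hy hxy
  rcases Finset.mem_insert.1 hx with hxv | hx' <;> rcases Finset.mem_insert.1 hy with hyv | hy'
  · exact absurd (hxv.trans hyv.symm) hxy
  · rw [hxv]; exact hN _ (hS hy')
  · rw [hyv, Sym2.eq_swap]; exact hN _ (hS hx')
  · exact hHG (hSe x hx' y hy' hxy)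

lemma HasClique.mono {G : Finset (Sym2 V)} {k : ℕ} {N N' : Finset V} (h : HasClique G k N)
    (hN : N ⊆ N') : HasClique G k N' := by
  obtain ⟨S, hS, hSc⟩ := h
  exact ⟨S, hS.trans hN, hSc⟩

lemma exists_missing_of_high_degree (q s : ℕ) (P : V → Fin (q + 1)) (B H : Finset (Sym2 V))
    (hBP : ∀ e ∈ B, (e.map P).IsDiag) (hdiag : ∀ e ∈ B ∪ H, ¬ e.IsDiag)
    (hclq : ¬ HasClique (B ∪ H) (q + 2) Finset.univ) (hopt : LocallyOptimal (B ∪ H) P) (v : V)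
    (hv : s ≤ (nbIn B Finset.univ v).card) :
    ∃ I : Finset (Fin (q + 1)), I.card = q + 1 ∧ ∃ N : Finset V,
      (∀ i ∈ I, s ≤ (N.filter fun x => P x = i).card) ∧ ¬ HasClique H (q + 1) N := by
  refine ⟨Finset.univ, by simp, nbIn (B ∪ H) Finset.univ v, ?_, ?_⟩
  · intro i _
    refine hv.trans (le_trans (Finset.card_le_card ?_) (hopt v i))
    intro w hw
    have hw := (mem_nbIn.1 hw).2
    refine Finset.mem_filter.2 ⟨mem_nbIn.2 ⟨Finset.mem_univ _, Finset.mem_union_left _ hw⟩, ?_⟩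
    have := hBP _ hw
    rw [Sym2.map_mk, Sym2.mk_isDiag_iff] at this
    exact this.symm
  · intro h
    refine hclq ((h.insert Finset.subset_union_right v ?_ ?_).mono (Finset.subset_univ _))
    · intro w hw
      exact (mem_nbIn.1 hw).2
    · intro h
      exact hdiag _ h (by simp)

lemma exists_missing_of_common_nbrs (q s : ℕ) (P : V → Fin (q + 1)) (B H : Finset (Sym2 V))
    (hdiag : ∀ e ∈ B ∪ H, ¬ e.IsDiag)
    (hclq : ¬ HasClique (B ∪ H) (q + 2) Finset.univ) (x y : V) (hxy : s(x, y) ∈ B)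
    (h : ∀ a, a ≠ P x →
      s ≤ (Finset.univ.filter fun w => P w = a ∧ s(x, w) ∈ H ∧ s(y, w) ∈ H).card) :
    ∃ I : Finset (Fin (q + 1)), I.card = q ∧ ∃ N : Finset V,
      (∀ i ∈ I, s ≤ (N.filter fun x => P x = i).card) ∧ ¬ HasClique H q N := by
  refine ⟨Finset.univ.erase (P x), by simp,
    Finset.univ.filter fun w => s(x, w) ∈ H ∧ s(y, w) ∈ H, ?_, ?_⟩
  · intro i hi
    refine (h i (Finset.ne_of_mem_erase hi)).trans (Finset.card_le_card ?_)
    intro w hw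
    simpa [and_comm, and_left_comm] using hw
  · intro hc
    have hv : ∀ v, s(v, v) ∉ B ∪ H := fun v h => hdiag _ h (by simp)
    have h1 := hc.insert (Finset.subset_union_right (s₁ := B)) y
      (fun w hw => Finset.mem_union_right _ (Finset.mem_filter.1 hw).2.2) (hv y)
    have h2 := h1.insert subset_rfl x ?_ (hv x)
    · exact hclq (h2.mono (Finset.subset_univ _))
    · intro w hw
      rcases Finset.mem_insert.1 hw with rfl | hw
      · exact Finset.mem_union_left _ hxy
      · exact Finset.mem_union_right _ (Finset.mem_filter.1 hw).2.1

/-- The number of ways to complete given inner edges `B` to a clique-free graph for which the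
partition `P` is optimal. -/
lemma card_completions_le (q : ℕ) (hq : 1 ≤ q) (P : V → Fin (q + 1)) (B : Finset (Sym2 V))
    (hBP : ∀ e ∈ B, (e.map P).IsDiag) (hBd : ∀ e ∈ B, ¬ e.IsDiag)
    (𝓗 : Finset (Finset (Sym2 V))) (h𝓗 : ∀ H ∈ 𝓗, H ⊆ crossSet P)
    (hclq : ∀ H ∈ 𝓗, ¬ HasClique (B ∪ H) (q + 2) Finset.univ)
    (hopt : ∀ H ∈ 𝓗, LocallyOptimal (B ∪ H) P)
    (X : ℕ) (hX : (crossSet P).card ≤ X) (W L : ℝ) (s₀ s₁ u ν c₀ : ℕ)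
    (hsmall : (∃ i, (Finset.univ.filter fun x => P x = i).card < c₀) →
      ((crossSet P).card : ℝ) * Real.log 2 + W ≤ X * Real.log 2)
    (hr : q + 1 ≤ Fintype.card V) (hs₀ : s₀ ≤ Fintype.card V) (hs₁ : s₁ ≤ Fintype.card V)
    (hL : 1 ≤ L)
    (hη : ((q + 1 : ℕ) + 3 + 2 * Real.log L) * ((q + 1 : ℕ) : ℝ) ^ 2 / L ≤ Real.log 2 / 4)
    (hcode₀ : 16 * L ^ (2 * (q + 1) + 3) * Real.log (Fintype.card V + 1) ≤ s₀)
    (hcode₁ : 16 * L ^ (2 * (q + 1) + 3) * Real.log (Fintype.card V + 1) ≤ s₁)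
    (hW₀ : Fintype.card V * Real.log 2 + W ≤ Real.log 2 / 4 * s₀ ^ 2)
    (hW₁ : Fintype.card V * Real.log 2 + W ≤ Real.log 2 / 4 * s₁ ^ 2)
    (hν : 2 * ν * s₀ ≤ B.card) (hu : u + 2 * ν ≤ c₀) (hus : 16 * s₁ ≤ u)
    (hWν : W ≤ ν * ((u : ℝ) / 16 - Real.log (q + 1))) :
    (𝓗.card : ℝ) ≤ 2 * (2 ^ X * Real.exp (-W)) := by
  have hpos : 0 ≤ (2 : ℝ) ^ X * Real.exp (-W) := by positivity
  have hm : (2 : ℝ) ≤ Fintype.card V := by exact_mod_cast (by omega : 2 ≤ Fintype.card V)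
  have hlm : 0 < Real.log (Fintype.card V + 1 : ℝ) := Real.log_pos (by linarith)
  have hpow : ∀ n : ℕ, (2 : ℝ) ^ n = Real.exp (n * Real.log 2) := fun n => by
    rw [Real.exp_nat_mul, Real.exp_log two_pos]
  have hgain : ∀ s : ℕ, Fintype.card V * Real.log 2 + W ≤ Real.log 2 / 4 * s ^ 2 →
      (2 : ℝ) ^ Fintype.card V * (2 ^ (crossSet P).card * Real.exp (-(Real.log 2 / 4 * s ^ 2))) ≤
      2 ^ X * Real.exp (-W) := by
    intro s hs
    have h1 : (2 : ℝ) ^ (crossSet P).card ≤ 2 ^ X := pow_le_pow_right₀ (by norm_num) hX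
    calc _ = (2 : ℝ) ^ (crossSet P).card *
          Real.exp (Fintype.card V * Real.log 2 - Real.log 2 / 4 * s ^ 2) := by
          rw [hpow (Fintype.card V), mul_left_comm, ← Real.exp_add]; ring_nf
      _ ≤ _ := by gcongr; linarith
  have hs₀1 : 1 ≤ s₀ := by
    by_contra hs
    obtain rfl : s₀ = 0 := by omega
    have : 0 < 16 * L ^ (2 * (q + 1) + 3) * Real.log (Fintype.card V + 1) := by positivity
    simp only [Nat.cast_zero] at hcode₀
    linarith
  have hs₁1 : 1 ≤ s₁ := by
    by_contra hs
    obtain rfl : s₁ = 0 := by omega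
    have : 0 < 16 * L ^ (2 * (q + 1) + 3) * Real.log (Fintype.card V + 1) := by positivity
    simp only [Nat.cast_zero] at hcode₁
    linarith
  have hdiag : ∀ H ∈ 𝓗, ∀ e ∈ B ∪ H, ¬ e.IsDiag := by
    intro H hH e he
    rcases Finset.mem_union.1 he with he | he
    · exact hBd e he
    · exact not_isDiag_of_mem_crossSet (h𝓗 H hH he)
  by_cases hcls : ∃ i, (Finset.univ.filter fun x => P x = i).card < c₀
  · have h1 : 𝓗.card ≤ 2 ^ (crossSet P).card := by
      rw [← Finset.card_powerset]
      exact Finset.card_le_card fun H hH => Finset.mem_powerset.2 (h𝓗 H hH)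
    have h2 : (𝓗.card : ℝ) ≤ 2 ^ (crossSet P).card := by exact_mod_cast h1
    have h3 : (2 : ℝ) ^ (crossSet P).card ≤ 2 ^ X * Real.exp (-W) := by
      rw [hpow, hpow, ← Real.exp_add, Real.exp_le_exp]
      linarith [hsmall hcls]
    linarith
  push Not at hcls
  by_cases hdeg : ∃ v, s₀ ≤ (nbIn B Finset.univ v).card
  · obtain ⟨v, hv⟩ := hdeg
    have h1 := card_missing_clique_le_of_le P (q + 1) (q + 1) s₀ (by omega) le_rfl hr hs₀ L hL hη
      hcode₀ 𝓗 h𝓗 fun H hH => exists_missing_of_high_degree q s₀ P B H hBP (hdiag H hH)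
        (hclq H hH) (hopt H hH) v hv
    linarith [hgain s₀ hW₀]
  push Not at hdeg
  obtain ⟨M, hMc, hM, hMB⟩ := exists_pairMatching B hBd s₀ hs₀1 (fun v => (hdeg v).le) ν hν
  have hMP : ∀ p ∈ M, P p.1 = P p.2 := fun p hp => by
    have := hBP _ (hMB p hp)
    rwa [Sym2.map_mk, Sym2.mk_isDiag_iff] at this
  let few : Finset (Sym2 V) → Prop := fun H => ∀ p ∈ M, ∃ a, a ≠ P p.1 ∧
    (Finset.univ.filter fun w =>
      (P w = a ∧ w ∉ pairVerts M) ∧ s(p.1, w) ∈ H ∧ s(p.2, w) ∈ H).card ≤ s₁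
  have hfew : ((𝓗.filter few).card : ℝ) ≤ 2 ^ X * Real.exp (-W) := by
    have h1 := card_few_common_nbrs_le P M hM hMP u s₁ ?_ (𝓗.filter few)
      (fun H hH => h𝓗 H (Finset.mem_filter.1 hH).1) (fun H hH => (Finset.mem_filter.1 hH).2)
    · refine h1.trans ?_
      rw [hMc, Fintype.card_fin]
      have h2 : (2 : ℝ) ^ (crossSet P).card ≤ 2 ^ X := pow_le_pow_right₀ (by norm_num) hX
      gcongr
      have h3 : (7 / 8 : ℝ) ^ u ≤ Real.exp (u * (-(1 / 8))) := by
        rw [Real.exp_nat_mul]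
        gcongr
        linarith [Real.add_one_le_exp (-(1 / 8) : ℝ)]
      have h4 : ((q + 1 : ℕ) : ℝ) = Real.exp (Real.log (q + 1)) := by
        rw [Real.exp_log (by positivity)]; push_cast; rfl
      have hus' : 16 * (s₁ : ℝ) ≤ u := by exact_mod_cast hus
      have hl2 := Real.log_two_lt_d9
      have h5 : ((q + 1 : ℕ) : ℝ) * ((7 / 8) ^ u * 2 ^ s₁) ≤
          Real.exp (Real.log (q + 1) - u / 16) := by
        calc ((q + 1 : ℕ) : ℝ) * ((7 / 8) ^ u * 2 ^ s₁)
            ≤ Real.exp (Real.log (q + 1)) *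
              (Real.exp (u * (-(1 / 8))) * Real.exp (s₁ * Real.log 2)) := by
              rw [← h4, ← hpow]; gcongr
          _ = Real.exp (Real.log (q + 1) + (u * (-(1 / 8)) + s₁ * Real.log 2)) := by
              rw [← Real.exp_add, ← Real.exp_add]
          _ ≤ _ := by
              rw [Real.exp_le_exp]
              have : (s₁ : ℝ) * Real.log 2 ≤ s₁ * 1 := by gcongr; linarith
              linarith
      calc _ ≤ Real.exp (Real.log (q + 1) - u / 16) ^ ν := by gcongr
        _ = Real.exp (ν * (Real.log (q + 1) - u / 16)) := by rw [Real.exp_nat_mul]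
        _ ≤ _ := by rw [Real.exp_le_exp]; linarith
    · intro a
      have h1 := hcls a
      have h2 := card_pairVerts_le M
      have h3 : (Finset.univ.filter fun w => P w = a ∧ w ∉ pairVerts M) =
          (Finset.univ.filter fun w => P w = a) \ pairVerts M := by
        ext w; simp
      rw [h3]
      have h4 := Finset.le_card_sdiff (pairVerts M) (Finset.univ.filter fun w => P w = a)
      omega
  have hmany : ((𝓗.filter fun H => ¬ few H).card : ℝ) ≤ 2 ^ X * Real.exp (-W) := by
    have key : ∀ H ∈ 𝓗.filter (fun H => ¬ few H), ∃ I : Finset (Fin (q + 1)), I.card = q ∧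
        ∃ N : Finset V, (∀ i ∈ I, s₁ ≤ (N.filter fun x => P x = i).card) ∧ ¬ HasClique H q N := by
      intro H hH
      obtain ⟨hH, hnf⟩ := Finset.mem_filter.1 hH
      simp only [few] at hnf
      push Not at hnf
      obtain ⟨p, hp, hcom⟩ := hnf
      refine exists_missing_of_common_nbrs q s₁ P B H (hdiag H hH) (hclq H hH) p.1 p.2 (hMB p hp) ?_
      intro a ha
      refine (hcom a ha).le.trans (Finset.card_le_card ?_)
      intro w hw
      simp only [Finset.mem_filter, Finset.mem_univ, true_and] at hw ⊢
      exact ⟨hw.1.1, hw.2⟩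
    by_cases hq2 : 2 ≤ q
    · have h1 := card_missing_clique_le_of_le P (q + 1) q s₁ hq2 (by omega) hr hs₁ L hL hη
        hcode₁ (𝓗.filter fun H => ¬ few H) (fun H hH => h𝓗 H (Finset.mem_filter.1 hH).1) key
      linarith [hgain s₁ hW₁]
    · have : 𝓗.filter (fun H => ¬ few H) = ∅ := by
        rw [Finset.eq_empty_iff_forall_notMem]
        intro H hH
        obtain ⟨I, hI, N, hN, hcl⟩ := key H hH
        obtain rfl : q = 1 := by omega
        obtain ⟨i, hi⟩ := Finset.card_pos.1 (by omega : 0 < I.card)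
        obtain ⟨w, hw⟩ := Finset.card_pos.1 (lt_of_lt_of_le (by omega : 0 < s₁) (hN i hi))
        refine hcl ⟨{w}, by simpa using (Finset.mem_filter.1 hw).1, by simp, ?_⟩
        intro x hx y hy hxy
        simp only [Finset.mem_singleton] at hx hy
        exact absurd (hx.trans hy.symm) hxy
      rw [this]
      simpa using hpos
  have hsplit : (𝓗.card : ℝ) = (𝓗.filter few).card + (𝓗.filter fun H => ¬ few H).card := by
    exact_mod_cast (Finset.card_filter_add_card_filter_not (s := 𝓗) few).symm
  linarith

end Parts

section NearPartite

variable {V : Type*} [Fintype V] [DecidableEq V]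

lemma monoCard_eq_add {κ : Type*} [DecidableEq κ] (G : Finset (Sym2 V)) (P : V → κ) (v : V) :
    monoCard G P = (G.filter fun e => v ∉ e ∧ (e.map P).IsDiag).card +
      ((nbIn G Finset.univ v).filter fun w => P w = P v).card := by
  rw [monoCard, ← Finset.card_filter_add_card_filter_not (s := G.filter fun e => (e.map P).IsDiag)
    (fun e => v ∉ e), Finset.filter_filter, Finset.filter_filter]
  congr 1
  · congr 1
    ext e
    simp [and_comm]
  · rw [← Finset.card_image_of_injOn (s := (nbIn G Finset.univ v).filter fun w => P w = P v)
      (f := fun w => s(v, w))]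
    · congr 1
      ext e
      simp only [Finset.mem_filter, Finset.mem_image, not_not, mem_nbIn, Finset.mem_univ, true_and]
      constructor
      · rintro ⟨he, hd, hv⟩
        obtain ⟨w, rfl⟩ := hv
        rw [Sym2.map_mk, Sym2.mk_isDiag_iff] at hd
        exact ⟨w, ⟨he, hd.symm⟩, rfl⟩
      · rintro ⟨w, ⟨he, hd⟩, rfl⟩
        refine ⟨he, ?_, Sym2.mem_mk_left _ _⟩
        rw [Sym2.map_mk, Sym2.mk_isDiag_iff, hd]
    · intro w _ w' _ h
      exact Sym2.congr_right.1 h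

lemma locallyOptimal_of_forall_le {κ : Type*} [DecidableEq κ] (G : Finset (Sym2 V))
    (hG : ∀ e ∈ G, ¬ e.IsDiag) (P : V → κ) (h : ∀ P' : V → κ, monoCard G P ≤ monoCard G P') :
    LocallyOptimal G P := by
  intro v i
  have h1 := h (Function.update P v i)
  rw [monoCard_eq_add G P v, monoCard_eq_add G (Function.update P v i) v] at h1
  have h2 : (G.filter fun e => v ∉ e ∧ (e.map (Function.update P v i)).IsDiag) =
      G.filter fun e => v ∉ e ∧ (e.map P).IsDiag := by
    refine Finset.filter_congr fun e _ => and_congr_right fun hv => ?_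
    rw [Sym2.map_congr fun w hw => ?_]
    rw [Function.update_of_ne]
    rintro rfl
    exact hv hw
  have h3 : ((nbIn G Finset.univ v).filter fun w =>
      Function.update P v i w = Function.update P v i v) =
      (nbIn G Finset.univ v).filter fun w => P w = i := by
    refine Finset.filter_congr fun w hw => ?_
    rw [Function.update_self, Function.update_of_ne]
    rintro rfl
    exact hG _ (mem_nbIn.1 hw).2 (by simp)
  rw [h2, h3] at h1
  omega

lemma sum_exp_card_le (hV : 1 ≤ Fintype.card V) :
    ∑ B : Finset (Sym2 V), Real.exp (-(3 * B.card * Real.log (Fintype.card V))) ≤ 3 := by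
  have hN : (Fintype.card (Sym2 V) : ℝ) ≤ (Fintype.card V : ℝ) ^ 2 := by
    have : Fintype.card (Sym2 V) ≤ Fintype.card (V × V) :=
      Fintype.card_le_of_surjective (fun p : V × V => s(p.1, p.2)) (Sym2.mk_surjective)
    rw [Fintype.card_prod, ← sq] at this
    exact_mod_cast this
  have hm : (1 : ℝ) ≤ Fintype.card V := by exact_mod_cast hV
  set m : ℝ := (Fintype.card V : ℝ)
  set y : ℝ := (m ^ 3)⁻¹
  have hy : ∀ b : ℕ, Real.exp (-(3 * b * Real.log m)) = y ^ b * 1 ^ (Fintype.card (Sym2 V) - b) := by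
    intro b
    rw [one_pow, mul_one, show -(3 * (b : ℝ) * Real.log m) = b * (-(3 * Real.log m)) by ring,
      Real.exp_nat_mul, Real.exp_neg]
    congr 2
    rw [← Real.exp_log (show 0 < m ^ 3 by positivity), Real.log_pow]
    norm_num
  have h1 := Finset.sum_pow_mul_eq_add_pow y 1 (Finset.univ : Finset (Sym2 V))
  rw [Finset.powerset_univ, Finset.card_univ] at h1
  simp_rw [hy]
  rw [h1]
  calc (y + 1) ^ Fintype.card (Sym2 V) ≤ Real.exp y ^ Fintype.card (Sym2 V) := by
        gcongr; exact Real.add_one_le_exp y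
    _ = Real.exp (Fintype.card (Sym2 V) * y) := by rw [Real.exp_nat_mul]
    _ ≤ Real.exp 1 := by
        gcongr
        rw [← div_eq_mul_inv, div_le_one (by positivity)]
        refine hN.trans ?_
        exact pow_le_pow_right₀ hm (by norm_num)
    _ ≤ 3 := by have := Real.exp_one_lt_d9; linarith

lemma card_far_near_le (q : ℕ) (hV : 1 ≤ Fintype.card V) (𝒢 : Finset (Finset (Sym2 V))) (t T Y : ℝ)
    (hY : 0 ≤ Y)
    (hdiag : ∀ G ∈ 𝒢, ∀ e ∈ G, ¬ e.IsDiag)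
    (hclq : ∀ G ∈ 𝒢, ¬ HasClique G (q + 2) Finset.univ)
    (hfar : ∀ G ∈ 𝒢, ∀ P : V → Fin (q + 1), t < monoCard G P)
    (hnear : ∀ G ∈ 𝒢, ∃ P : V → Fin (q + 1), (monoCard G P : ℝ) < T)
    (hcount : ∀ (P : V → Fin (q + 1)) (B : Finset (Sym2 V)) (𝓗 : Finset (Finset (Sym2 V))),
      (∀ e ∈ B, (e.map P).IsDiag) → (∀ e ∈ B, ¬ e.IsDiag) → t < B.card → (B.card : ℝ) < T →
      (∀ H ∈ 𝓗, H ⊆ crossSet P) → (∀ H ∈ 𝓗, ¬ HasClique (B ∪ H) (q + 2) Finset.univ) →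
      (∀ H ∈ 𝓗, LocallyOptimal (B ∪ H) P) →
      (𝓗.card : ℝ) ≤ Y * Real.exp (-(3 * B.card * Real.log (Fintype.card V)))) :
    (𝒢.card : ℝ) ≤ (q + 1) ^ Fintype.card V * (3 * Y) := by
  let good : (V → Fin (q + 1)) → Finset (Sym2 V) → Prop := fun P B =>
    (∀ e ∈ B, (e.map P).IsDiag) ∧ (∀ e ∈ B, ¬ e.IsDiag) ∧ t < B.card ∧ (B.card : ℝ) < T
  let comp : (V → Fin (q + 1)) → Finset (Sym2 V) → Finset (Finset (Sym2 V)) := fun P B =>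
    if good P B then (crossSet P).powerset.filter fun H =>
      ¬ HasClique (B ∪ H) (q + 2) Finset.univ ∧ LocallyOptimal (B ∪ H) P else ∅
  have hcomp : ∀ P B, ((comp P B).card : ℝ) ≤
      Y * Real.exp (-(3 * B.card * Real.log (Fintype.card V))) := by
    intro P B
    by_cases hg : good P B
    · have hmem : ∀ H ∈ comp P B, H ⊆ crossSet P ∧ ¬ HasClique (B ∪ H) (q + 2) Finset.univ ∧
          LocallyOptimal (B ∪ H) P := by
        intro H hH
        simp only [comp, if_pos hg, Finset.mem_filter, Finset.mem_powerset] at hH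
        exact hH
      exact hcount P B _ hg.1 hg.2.1 hg.2.2.1 hg.2.2.2 (fun H hH => (hmem H hH).1)
        (fun H hH => (hmem H hH).2.1) (fun H hH => (hmem H hH).2.2)
    · simp only [comp, if_neg hg, Finset.card_empty, Nat.cast_zero]
      positivity
  have hcover : 𝒢 ⊆ Finset.univ.biUnion fun P : V → Fin (q + 1) =>
      Finset.univ.biUnion fun B => (comp P B).image fun H => B ∪ H := by
    intro G hG
    obtain ⟨P, -, hP⟩ := Finset.exists_min_image (Finset.univ : Finset (V → Fin (q + 1)))
      (monoCard G) ⟨fun _ => 0, Finset.mem_univ _⟩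
    set B := G.filter fun e => (e.map P).IsDiag with hB
    set H := G.filter fun e => ¬ (e.map P).IsDiag with hH
    have hBH : B ∪ H = G := Finset.filter_union_filter_not_eq _ _
    have hg : good P B := by
      refine ⟨fun e he => (Finset.mem_filter.1 he).2,
        fun e he => hdiag G hG e (Finset.mem_filter.1 he).1, hfar G hG P, ?_⟩
      obtain ⟨P', hP'⟩ := hnear G hG
      refine lt_of_le_of_lt ?_ hP'
      exact_mod_cast hP P' (Finset.mem_univ _)
    refine Finset.mem_biUnion.2 ⟨P, Finset.mem_univ _, Finset.mem_biUnion.2 ⟨B, Finset.mem_univ _,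
      Finset.mem_image.2 ⟨H, ?_, hBH⟩⟩⟩
    simp only [comp, if_pos hg, Finset.mem_filter, Finset.mem_powerset, hBH]
    refine ⟨fun e he => Finset.mem_filter.2 ⟨Finset.mem_univ _, (Finset.mem_filter.1 he).2⟩,
      hclq G hG, locallyOptimal_of_forall_le G (hdiag G hG) P fun P' => hP P' (Finset.mem_univ _)⟩
  have h1 : 𝒢.card ≤ ∑ P : V → Fin (q + 1), ∑ B, (comp P B).card := by
    refine (Finset.card_le_card hcover).trans (Finset.card_biUnion_le.trans ?_)
    refine Finset.sum_le_sum fun P _ => Finset.card_biUnion_le.trans ?_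
    exact Finset.sum_le_sum fun B _ => Finset.card_image_le
  calc (𝒢.card : ℝ) ≤ ∑ P : V → Fin (q + 1), ∑ B, ((comp P B).card : ℝ) := by exact_mod_cast h1
    _ ≤ ∑ P : V → Fin (q + 1), ∑ B,
        Y * Real.exp (-(3 * B.card * Real.log (Fintype.card V))) :=
        Finset.sum_le_sum fun P _ => Finset.sum_le_sum fun B _ => hcomp P B
    _ ≤ ∑ P : V → Fin (q + 1), 3 * Y := by
        refine Finset.sum_le_sum fun P _ => ?_
        rw [← Finset.mul_sum, mul_comm 3]
        exact mul_le_mul_of_nonneg_left (sum_exp_card_le hV) hY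
    _ = _ := by
        rw [Finset.sum_const, nsmul_eq_mul, Finset.card_univ, Fintype.card_fun, Fintype.card_fin]
        push_cast
        rfl

end NearPartite

section Transfer

lemma le_exKr {m r : ℕ} (H : SimpleGraph (Fin m)) (h : H.CliqueFree (r + 1)) :
    H.edgeSet.ncard ≤ exKr m r := by
  refine le_csSup ⟨Fintype.card (Sym2 (Fin m)), ?_⟩ ⟨H, h, rfl⟩
  rintro c ⟨H, -, rfl⟩
  rw [← Nat.card_eq_fintype_card]
  exact Set.ncard_le_card _

lemma card_crossSet_le_exKr {m r : ℕ} (P : Fin m → Fin r) : (crossSet P).card ≤ exKr m r := by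
  let H : SimpleGraph (Fin m) := (⊤ : SimpleGraph (Fin r)).comap P
  have hH : H.CliqueFree (r + 1) := by
    have : H.Colorable r := ⟨SimpleGraph.Coloring.mk P fun h => h⟩
    exact this.cliqueFree (Nat.lt_succ_self r)
  have h1 : H.edgeSet = (crossSet P : Set (Sym2 (Fin m))) := by
    ext e
    induction e using Sym2.ind with
    | _ x y => simp [H, mk_mem_crossSet]
  have := le_exKr H hH
  rwa [h1, Set.ncard_coe_finset] at this

lemma turan_le_exKr {m r : ℕ} (hr : 1 ≤ r) :
    (1 - 1 / (r : ℝ)) * (m : ℝ) ^ 2 / 2 - r ^ 2 / 2 - 1 ≤ exKr m r := by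
  have h1 := le_exKr (SimpleGraph.turanGraph m r) (SimpleGraph.turanGraph_cliqueFree hr)
  rw [← SimpleGraph.coe_edgeFinset, Set.ncard_coe_finset,
    SimpleGraph.card_edgeFinset_turanGraph] at h1
  have hρ : m % r < r := Nat.mod_lt _ hr
  have hρm : m % r ≤ m := Nat.mod_le _ _
  set ρ := m % r
  have h2 : (m ^ 2 - ρ ^ 2) * (r - 1) < ((m ^ 2 - ρ ^ 2) * (r - 1) / (2 * r) + 1) * (2 * r) :=
    (Nat.div_lt_iff_lt_mul (by omega)).1 (Nat.lt_succ_self _)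
  have h3 : (m ^ 2 - ρ ^ 2) * (r - 1) / (2 * r) ≤ exKr m r := by omega
  have h4 : (m ^ 2 - ρ ^ 2) * (r - 1) ≤ (exKr m r + 1) * (2 * r) := by
    refine h2.le.trans ?_
    gcongr
  have h5 : (((m : ℝ) ^ 2 - ρ ^ 2) * (r - 1)) ≤ (exKr m r + 1) * (2 * r) := by
    have := (Nat.cast_le (α := ℝ)).2 h4
    rw [Nat.cast_mul, Nat.cast_sub (Nat.pow_le_pow_left hρm 2), Nat.cast_sub hr] at this
    push_cast at this
    exact this
  have hr0 : (0 : ℝ) < r := by exact_mod_cast hr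
  have hρr : (ρ : ℝ) ≤ r := by exact_mod_cast hρ.le
  have h6 : (ρ : ℝ) ^ 2 ≤ r ^ 2 := by gcongr
  have h7 : ((m : ℝ) ^ 2 - ρ ^ 2) * (r - 1) / (2 * r) ≤ exKr m r + 1 := by
    rw [div_le_iff₀ (by positivity)]; exact h5
  have h8 : ((m : ℝ) ^ 2 - ρ ^ 2) * (r - 1) / (2 * r) =
      (1 - 1 / (r : ℝ)) * (m : ℝ) ^ 2 / 2 - (1 - 1 / (r : ℝ)) * ρ ^ 2 / 2 := by
    field_simp
  have h9 : (1 - 1 / (r : ℝ)) * ρ ^ 2 ≤ 1 * r ^ 2 := by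
    have : 0 ≤ 1 / (r : ℝ) := by positivity
    gcongr
    linarith
  linarith

lemma card_crossSet_le_of_small {m r : ℕ} (hr : 1 ≤ r) (P : Fin m → Fin r) (i : Fin r)
    (hi : ((Finset.univ.filter fun x => P x = i).card : ℝ) ≤ m / (2 * r)) :
    ((crossSet P).card : ℝ) ≤ (1 - 1 / (r : ℝ)) * (m : ℝ) ^ 2 / 2 - m ^ 2 / (8 * r ^ 2) := by
  have hr0 : (0 : ℝ) < r := by exact_mod_cast hr
  have h1 : (2 : ℝ) * (crossSet P).card = crossCard P := by exact_mod_cast two_mul_card_crossSet P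
  rw [crossCard_eq, Fintype.card_fin] at h1
  set n : Fin r → ℝ := fun j => ((Finset.univ.filter fun x => P x = j).card : ℝ)
  have h2 : ∑ j, n j = m := by simpa using sum_card_fiber P
  have h3 : ∑ j, (n j - m / r) ^ 2 = ∑ j, n j ^ 2 - m ^ 2 / r := by
    simp_rw [sub_sq, Finset.sum_add_distrib, Finset.sum_sub_distrib, ← Finset.sum_mul,
      ← Finset.mul_sum, h2]
    simp
    field_simp
    ring
  have h4 : (n i - m / r) ^ 2 ≤ ∑ j, (n j - m / r) ^ 2 :=
    Finset.single_le_sum (f := fun j => (n j - m / r) ^ 2) (fun j _ => sq_nonneg _)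
      (Finset.mem_univ i)
  have h5 : (m / (2 * r) : ℝ) ^ 2 ≤ (m / r - n i) ^ 2 := by
    gcongr
    have : (m : ℝ) / r = m / (2 * r) + m / (2 * r) := by field_simp; ring
    have hi' : n i ≤ m / (2 * r) := hi
    linarith
  have h6 : (m / (2 * r) : ℝ) ^ 2 = 2 * (m ^ 2 / (8 * r ^ 2)) := by field_simp; ring
  have h7 : (1 - 1 / (r : ℝ)) * (m : ℝ) ^ 2 = m ^ 2 - m ^ 2 / r := by ring
  have h8 : (n i - m / r) ^ 2 = (m / r - n i) ^ 2 := by ring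
  have h9 : ∑ j, ((Finset.univ.filter fun x => P x = j).card : ℝ) ^ 2 = ∑ j, n j ^ 2 := rfl
  rw [h9] at h1
  linarith

lemma isDiag_map_iff {V κ : Type*} (f : V → κ) (e : Sym2 V) :
    (e.map f).IsDiag ↔ ∃ c, ∀ v ∈ e, f v = c := by
  induction e using Sym2.ind with
  | _ x y =>
    rw [Sym2.map_mk, Sym2.mk_isDiag_iff]
    constructor
    · intro h
      exact ⟨f x, by simp [h]⟩
    · rintro ⟨c, hc⟩
      rw [hc x (by simp), hc y (by simp)]

lemma exists_finset_card_eq (m q : ℕ) (t : ℝ) : ∃ 𝒢 : Finset (Finset (Sym2 (Fin m))),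
    Nat.card {H : SimpleGraph (Fin m) // H.CliqueFree (q + 2) ∧
      GraphFarFromPartite H (q + 1) t} = 𝒢.card ∧
    (∀ G ∈ 𝒢, ∀ e ∈ G, ¬ e.IsDiag) ∧ (∀ G ∈ 𝒢, ¬ HasClique G (q + 2) Finset.univ) ∧
    ∀ G ∈ 𝒢, ∀ P : Fin m → Fin (q + 1), t < monoCard G P := by
  refine ⟨(Finset.univ.filter fun H : SimpleGraph (Fin m) => H.CliqueFree (q + 2) ∧
      GraphFarFromPartite H (q + 1) t).image fun H => H.edgeFinset, ?_, ?_, ?_, ?_⟩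
  · rw [Finset.card_image_of_injective _ fun H H' h => SimpleGraph.edgeFinset_inj.1 h,
      Nat.card_eq_fintype_card, Fintype.card_subtype]
  · intro G hG e he
    obtain ⟨H, -, rfl⟩ := Finset.mem_image.1 hG
    exact H.not_isDiag_of_mem_edgeFinset he
  · intro G hG hc
    obtain ⟨H, hH, rfl⟩ := Finset.mem_image.1 hG
    obtain ⟨S, -, hS, hSe⟩ := hc
    refine (Finset.mem_filter.1 hH).2.1 S ⟨?_, hS⟩
    intro x hx y hy hxy
    simpa using hSe x hx y hy hxy
  · intro G hG P
    obtain ⟨H, hH, rfl⟩ := Finset.mem_image.1 hG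
    have := (Finset.mem_filter.1 hH).2.2 P
    convert this using 2
    rw [monoEdges, monoCard, ← Set.ncard_coe_finset]
    congr 1
    ext e
    simp [isDiag_map_iff]

end Transfer

section RealInequalities

variable {l w m b β s ν : ℝ}

lemma sqrt_bound_above (hl : 10 ^ 8 ≤ l) (hm : 0 < m) (hb : b ≤ m ^ 2 / l ^ 8) :
    Real.sqrt (l * b) ≤ m / (10 ^ 6 * l ^ 2) := by
  have hl0 : 0 < l := lt_of_lt_of_le (by norm_num) hl
  refine Real.sqrt_le_iff.2 ⟨by positivity, ?_⟩
  calc l * b ≤ l * (m ^ 2 / l ^ 8) := by gcongr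
    _ = m ^ 2 / (l ^ 3 * l ^ 4) := by field_simp
    _ ≤ m ^ 2 / (10 ^ 12 * l ^ 4) := by
      gcongr
      calc (10 : ℝ) ^ 12 ≤ (10 ^ 8) ^ 3 := by norm_num
        _ ≤ l ^ 3 := by gcongr
    _ = (m / (10 ^ 6 * l ^ 2)) ^ 2 := by field_simp

lemma pow_eleven_le (hl : 1 ≤ l) (hw : 10 ^ 9 * l ^ 10 ≤ w) (hm : m = w ^ 20) :
    w ^ 11 + 1 ≤ m / (10 ^ 6 * l ^ 2) := by
  have hl0 : 0 < l := by linarith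
  have hw1 : 1 ≤ w := by
    have : 1 ≤ l ^ 10 := one_le_pow₀ hl
    linarith
  have hw2 : 10 ^ 9 * l ^ 2 ≤ w := by
    refine le_trans ?_ hw
    gcongr
    norm_num
  rw [le_div_iff₀ (by positivity)]
  have h1 : (1 : ℝ) ≤ w ^ 11 := one_le_pow₀ hw1
  have h2 : 0 ≤ w ^ 11 * l ^ 2 := by positivity
  calc (w ^ 11 + 1) * (10 ^ 6 * l ^ 2) ≤ (2 * w ^ 11) * (10 ^ 6 * l ^ 2) := by gcongr; linarith
    _ ≤ w ^ 11 * (10 ^ 9 * l ^ 2) := by linarith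
    _ ≤ w ^ 11 * w := by gcongr
    _ = w ^ 12 := by ring
    _ ≤ w ^ 20 := pow_le_pow_right₀ hw1 (by norm_num)
    _ = m := hm.symm

lemma sqrt_add_pow_le (hl : 1 ≤ l) (hw : 10 ^ 9 * l ^ 10 ≤ w) (hb : w ^ 12 < b) :
    10 * Real.sqrt (l * b) + w ^ 11 + 1 ≤ b / (1024 * l ^ 4) := by
  have hl0 : 0 < l := by linarith
  have hw1 : 1 ≤ w := by
    have : 1 ≤ l ^ 10 := one_le_pow₀ hl
    linarith
  have hb0 : 0 < b := lt_trans (by positivity) hb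
  have h1 : Real.sqrt (l * b) ≤ b / (20480 * l ^ 4) := by
    refine Real.sqrt_le_iff.2 ⟨by positivity, ?_⟩
    rw [div_pow, le_div_iff₀ (by positivity)]
    have h2 : l ^ 9 * 20480 ^ 2 ≤ b := by
      calc l ^ 9 * 20480 ^ 2 ≤ l ^ 10 * 10 ^ 9 := by
            gcongr
            · norm_num
            · norm_num
        _ ≤ w ^ 1 := by linarith
        _ ≤ w ^ 12 := pow_le_pow_right₀ hw1 (by norm_num)
        _ ≤ b := hb.le
    calc l * b * (20480 * l ^ 4) ^ 2 = b * (l ^ 9 * 20480 ^ 2) := by ring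
      _ ≤ b * b := by gcongr
      _ = b ^ 2 := by ring
  have h3 : w ^ 11 + 1 ≤ b / (2048 * l ^ 4) := by
    rw [le_div_iff₀ (by positivity)]
    have h4 : (1 : ℝ) ≤ w ^ 11 := one_le_pow₀ hw1
    have h5 : 4096 * l ^ 4 ≤ w := by
      refine le_trans ?_ hw
      gcongr
      · norm_num
      · norm_num
    calc (w ^ 11 + 1) * (2048 * l ^ 4) ≤ (w ^ 11 + w ^ 11) * (2048 * l ^ 4) := by gcongr
      _ = w ^ 11 * (4096 * l ^ 4) := by ring
      _ ≤ w ^ 11 * w := by gcongr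
      _ = w ^ 12 := by ring
      _ ≤ b := hb.le
  have h6 : b / (1024 * l ^ 4) = 10 * (b / (20480 * l ^ 4)) + b / (2048 * l ^ 4) := by
    field_simp
    norm_num
  linarith

lemma le_mul_of_div_le (hl : 1 ≤ l) (hm : 0 < m) (hb : 0 < b) (hs : 0 < s)
    (hsm : s ≤ m / (3072 * l ^ 2)) (hsb : s ≤ b / (1024 * l ^ 4)) (hν : b / (4 * s) ≤ ν)
    {y : ℝ} (hy : m / (128 * l) ≤ y) : m * l ^ 3 + 3 * b * l ≤ ν * y := by
  have hl0 : 0 < l := by linarith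
  have h1 : b / (4 * s) * (m / (128 * l)) ≤ ν * y := by
    have : 0 ≤ b / (4 * s) := by positivity
    gcongr
    linarith
  have h2 : b / (4 * s) * (m / (128 * l)) = b * m / (1024 * l * s) + b * m / (1024 * l * s) := by
    field_simp
    norm_num
  have h3 : 3 * b * l ≤ b * m / (1024 * l * s) := by
    rw [le_div_iff₀ (by positivity)]
    rw [le_div_iff₀ (by positivity)] at hsm
    calc 3 * b * l * (1024 * l * s) = b * (s * (3072 * l ^ 2)) := by ring
      _ ≤ b * m := by gcongr
  have h4 : m * l ^ 3 ≤ b * m / (1024 * l * s) := by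
    rw [le_div_iff₀ (by positivity)]
    rw [le_div_iff₀ (by positivity)] at hsb
    calc m * l ^ 3 * (1024 * l * s) = (s * (1024 * l ^ 4)) * m := by ring
      _ ≤ b * m := by gcongr
  linarith

lemma three_mul_le (hl : 10 ^ 8 ≤ l) (hm : 0 < m) (hb : b ≤ m ^ 2 / l ^ 8) :
    3 * b * l ≤ m ^ 2 / l ^ 2 / 10 ^ 7 := by
  have hl0 : 0 < l := lt_of_lt_of_le (by norm_num) hl
  calc 3 * b * l ≤ 3 * (m ^ 2 / l ^ 8) * l := by gcongr
    _ = m ^ 2 / l ^ 2 * (3 / l ^ 5) := by field_simp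
    _ ≤ m ^ 2 / l ^ 2 * (3 / (10 ^ 8) ^ 5) := by gcongr
    _ ≤ m ^ 2 / l ^ 2 * (1 / 10 ^ 7) := by gcongr ?_ * ?_; norm_num
    _ = _ := by ring

lemma mul_cube_le (hl : 1 ≤ l) (hm : 10 ^ 9 * l ^ 10 ≤ m) :
    m * l ^ 3 ≤ m ^ 2 / l ^ 2 / 10 ^ 7 := by
  have hl0 : 0 < l := by linarith
  have hm0 : 0 < m := lt_of_lt_of_le (by positivity) hm
  rw [div_div, le_div_iff₀ (by positivity)]
  have : l ^ 5 * 10 ^ 7 ≤ m := by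
    refine le_trans ?_ hm
    rw [mul_comm]
    gcongr ?_ * l ^ ?_
    · norm_num
    · norm_num
  calc m * l ^ 3 * (l ^ 2 * 10 ^ 7) = m * (l ^ 5 * 10 ^ 7) := by ring
    _ ≤ m * m := by gcongr
    _ = m ^ 2 := by ring

lemma diag_loss_le (hl : 10 ^ 8 ≤ l) {q L : ℝ} (hq0 : 0 ≤ q) (hq : q + 1 ≤ l)
    (hL : L = l ^ 10) : (q + 1 + 3 + 2 * Real.log L) * (q + 1) ^ 2 / L ≤ Real.log 2 / 4 := by
  have hl0 : 0 < l := lt_of_lt_of_le (by norm_num) hl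
  have h1 : Real.log L ≤ 10 * l := by
    rw [hL, Real.log_pow]
    push_cast
    have := Real.log_le_sub_one_of_pos hl0
    linarith
  have h2 : q + 1 + 3 + 2 * Real.log L ≤ 25 * l := by linarith
  have := Real.log_two_gt_d9
  calc (q + 1 + 3 + 2 * Real.log L) * (q + 1) ^ 2 / L ≤ 25 * l * l ^ 2 / L := by
        have : 0 < L := by rw [hL]; positivity
        gcongr
    _ = 25 / l ^ 7 := by rw [hL]; field_simp
    _ ≤ 25 / (10 ^ 8) ^ 7 := by gcongr
    _ ≤ Real.log 2 / 4 := by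
      have : (25 : ℝ) / (10 ^ 8) ^ 7 ≤ 0.1 := by norm_num
      linarith

lemma entropy_le_sq (hl : 1 ≤ l) (hw : 10 ^ 9 * l ^ 10 ≤ w) (hm : m = w ^ 20) (hb : 0 < b)
    (hs : 10 * Real.sqrt (l * b) + w ^ 11 ≤ s) :
    m * Real.log 2 + (m * l ^ 3 + 3 * b * l) ≤ Real.log 2 / 4 * s ^ 2 := by
  have hl0 : 0 < l := by linarith
  have h10 : l ^ 3 ≤ l ^ 10 := pow_le_pow_right₀ hl (by norm_num)
  have h3 : 1 ≤ l ^ 3 := one_le_pow₀ hl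
  have hw1 : 1 ≤ w := by linarith
  have hm0 : 0 < m := by rw [hm]; positivity
  have h1 : (10 * Real.sqrt (l * b) + w ^ 11) ^ 2 ≤ s ^ 2 := by gcongr
  have h2 : Real.sqrt (l * b) ^ 2 = l * b := Real.sq_sqrt (by positivity)
  have h4 : 100 * (l * b) + m * w ^ 2 ≤ s ^ 2 := by
    have : (0 : ℝ) ≤ Real.sqrt (l * b) * w ^ 11 := by positivity
    rw [hm]
    nlinarith
  have h5 : 10 * l ^ 3 + 10 ≤ w ^ 2 := by nlinarith
  have h6 : m * (10 * l ^ 3 + 10) ≤ m * w ^ 2 := by gcongr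
  have := Real.log_two_gt_d9
  have := Real.log_two_lt_d9
  have h7 : (0.17 : ℝ) * s ^ 2 ≤ Real.log 2 / 4 * s ^ 2 := by gcongr; linarith
  have h8 : m * Real.log 2 ≤ m * 1 := by gcongr; linarith
  have h9 : 0 < l * b := by positivity
  have h11 : 0 < m * l ^ 3 := by positivity
  linarith

lemma half_div_le (hl : 10 ^ 8 ≤ l) (hm : 0 < m) (hb0 : 0 < b) (hb : b ≤ m ^ 2 / l ^ 8)
    (hs : 10 * Real.sqrt (l * b) ≤ s) (hν : ν ≤ b / (2 * s)) : 2 * ν ≤ m / l / 4 := by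
  have hl0 : 0 < l := lt_of_lt_of_le (by norm_num) hl
  have hβ0 : 0 < Real.sqrt (l * b) := Real.sqrt_pos.2 (by positivity)
  have hβ2 : Real.sqrt (l * b) ^ 2 = l * b := Real.sq_sqrt (by positivity)
  have hβu := sqrt_bound_above hl hm hb
  set β := Real.sqrt (l * b)
  have hbβ : b = β ^ 2 / l := by rw [hβ2]; field_simp
  calc 2 * ν ≤ 2 * (b / (2 * (10 * β))) := by
        refine mul_le_mul_of_nonneg_left (hν.trans ?_) (by norm_num)
        gcongr
    _ = β / l / 10 := by rw [hbβ]; field_simp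
    _ ≤ m / (10 ^ 6 * l ^ 2) / l / 10 := by gcongr
    _ = m / l * (1 / (10 ^ 7 * l ^ 2)) := by field_simp
    _ ≤ m / l * (1 / 4) := by
      gcongr
      nlinarith
    _ = m / l / 4 := by ring

lemma code_le {q : ℕ} {L : ℝ} (hl : 1 ≤ l) (hw : 10 ^ 9 * l ^ 10 ≤ w) (hL : 1 ≤ L)
    (hLw : L ^ (2 * q + 7) ≤ w) {y : ℝ} (hy0 : 0 ≤ y) (hy : y ≤ 2 * l) :
    16 * L ^ (2 * (q + 1) + 3) * y ≤ w ^ 2 := by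
  have h1 : L ^ (2 * (q + 1) + 3) ≤ w :=
    le_trans (pow_le_pow_right₀ hL (by omega)) hLw
  have h10 : l ≤ l ^ 10 := le_self_pow₀ hl (by norm_num)
  have hw0 : 0 ≤ w := by linarith
  calc 16 * L ^ (2 * (q + 1) + 3) * y ≤ 16 * w * (2 * l) := by gcongr
    _ = w * (32 * l) := by ring
    _ ≤ w * w := by gcongr; linarith
    _ = w ^ 2 := by ring

lemma log_add_one_le_two_mul {n : ℕ} (hn : 2 ≤ n) : Real.log (n + 1) ≤ 2 * Real.log n := by
  have hn' : (2 : ℝ) ≤ n := by exact_mod_cast hn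
  have : 2 * Real.log n = Real.log ((n : ℝ) ^ 2) := by rw [Real.log_pow]; norm_num
  rw [this]
  apply Real.log_le_log (by linarith)
  nlinarith

end RealInequalities

section ParameterChoice

set_option maxHeartbeats 1000000 in
/-- The completion count with all parameters chosen. -/
lemma card_completions_le_exp (m q : ℕ) (hq : 1 ≤ q) {w l b : ℝ}
    (hmw : (m : ℝ) = w ^ 20) (hlm : l = Real.log m)
    (hl : 10 ^ 8 ≤ l) (hw : 10 ^ 9 * l ^ 10 ≤ w) (hr : (q : ℝ) + 1 ≤ l)
    (hLw : (l ^ 10) ^ (2 * q + 7) ≤ w)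
    (P : Fin m → Fin (q + 1)) (B : Finset (Sym2 (Fin m))) (𝓗 : Finset (Finset (Sym2 (Fin m))))
    (hBP : ∀ e ∈ B, (e.map P).IsDiag) (hBd : ∀ e ∈ B, ¬ e.IsDiag)
    (hbB : b = B.card) (hb : w ^ 12 < b) (hb' : b < (m : ℝ) ^ 2 / l ^ 8)
    (h𝓗 : ∀ H ∈ 𝓗, H ⊆ crossSet P)
    (hclq : ∀ H ∈ 𝓗, ¬ HasClique (B ∪ H) (q + 2) Finset.univ)
    (hopt : ∀ H ∈ 𝓗, LocallyOptimal (B ∪ H) P) :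
    (𝓗.card : ℝ) ≤ 2 * (2 ^ exKr m (q + 1) * Real.exp (-(m * l ^ 3 + 3 * b * l))) := by
  have hl1 : (1 : ℝ) ≤ l := le_trans (by norm_num) hl
  have hl0 : 0 < l := by linarith
  have hl10 : l ≤ l ^ 10 := le_self_pow₀ hl1 (by norm_num)
  have hw1 : (1 : ℝ) ≤ w := by linarith
  have hb0 : 0 < b := lt_trans (by positivity) hb
  have hm0 : (0 : ℝ) < m := by rw [hmw]; positivity
  have hwm : w ^ 3 ≤ m := hmw ▸ pow_le_pow_right₀ hw1 (by norm_num)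
  have hwm1 : w ≤ m := le_trans (le_self_pow₀ hw1 (by norm_num)) hwm
  have hml : 10 ^ 9 * w ^ 2 ≤ m / l := by
    rw [le_div_iff₀ hl0]
    calc 10 ^ 9 * w ^ 2 * l = w ^ 2 * (10 ^ 9 * l) := by ring
      _ ≤ w ^ 2 * w := by gcongr; linarith
      _ ≤ m := by linarith
  have hww : w ≤ w ^ 2 := le_self_pow₀ hw1 (by norm_num)
  have hm2 : 2 ≤ m := by
    have : (2 : ℝ) ≤ m := by linarith
    exact_mod_cast this
  have hlog : Real.log (m + 1) ≤ 2 * l := hlm ▸ log_add_one_le_two_mul hm2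
  have hmr : m / l ≤ m / ((q : ℝ) + 1) := by gcongr
  have hL : 1 ≤ l ^ 10 := one_le_pow₀ hl1
  have hβu := sqrt_bound_above hl hm0 hb'.le
  have hw11 := pow_eleven_le hl1 hw hmw
  have hsb := sqrt_add_pow_le hl1 hw hb
  have hβ0 := Real.sqrt_nonneg (l * b)
  obtain ⟨s₀, hs₀l, hs₀u⟩ : ∃ s₀ : ℕ, 10 * Real.sqrt (l * b) + w ^ 11 ≤ s₀ ∧
      (s₀ : ℝ) ≤ 10 * Real.sqrt (l * b) + w ^ 11 + 1 :=
    ⟨_, Nat.le_ceil _, (Nat.ceil_lt_add_one (by positivity)).le⟩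
  obtain ⟨u, hul, huu⟩ : ∃ u : ℕ, (m / ((q : ℝ) + 1)) / 4 - 1 ≤ u ∧
      (u : ℝ) ≤ (m / ((q : ℝ) + 1)) / 4 :=
    ⟨_, (Nat.sub_one_lt_floor _).le, Nat.floor_le (by positivity)⟩
  obtain ⟨c₀, hc₀l, hc₀u⟩ : ∃ c₀ : ℕ, (m / ((q : ℝ) + 1)) / 2 ≤ c₀ ∧
      ∀ n : ℕ, n < c₀ → (n : ℝ) ≤ (m / ((q : ℝ) + 1)) / 2 :=
    ⟨_, Nat.le_ceil _, fun n hn => (Nat.lt_ceil.1 hn).le⟩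
  obtain ⟨s₁, hs₁u, hs₁l⟩ : ∃ s₁ : ℕ, 16 * s₁ ≤ u ∧ (u : ℝ) / 16 - 1 ≤ s₁ := by
    refine ⟨u / 16, by omega, ?_⟩
    have h1 : u < 16 * (u / 16 + 1) := by omega
    have h2 : (u : ℝ) < 16 * ((u / 16 : ℕ) + 1) := by exact_mod_cast h1
    linarith
  have hs₁l' : m / l / 128 ≤ s₁ := by linarith
  have hs₀w : w ^ 11 ≤ s₀ := by linarith
  have hs₀0 : (0 : ℝ) < s₀ := lt_of_lt_of_le (by positivity) hs₀w
  have hs₀b := hs₀u.trans hsb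
  obtain ⟨ν, hνB, hνu, hνl⟩ : ∃ ν : ℕ, 2 * ν * s₀ ≤ B.card ∧ (ν : ℝ) ≤ b / (2 * s₀) ∧
      b / (4 * s₀) ≤ ν := by
    have hs : 0 < 2 * s₀ := by
      have : 0 < s₀ := by exact_mod_cast hs₀0
      omega
    refine ⟨B.card / (2 * s₀), ?_, ?_, ?_⟩
    · have := Nat.div_mul_le_self B.card (2 * s₀)
      linarith
    · have := Nat.cast_div_le (α := ℝ) (m := B.card) (n := 2 * s₀)
      push_cast at this
      rwa [← hbB] at this
    · have h1 : B.card < 2 * s₀ * (B.card / (2 * s₀) + 1) := Nat.lt_mul_div_succ _ hs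
      have h2 : b < 2 * s₀ * ((B.card / (2 * s₀) : ℕ) + 1) := by rw [hbB]; exact_mod_cast h1
      have h3 : 2 ≤ b / (2 * s₀) := by
        rw [le_div_iff₀ (by positivity)]
        have h4 : (s₀ : ℝ) * (1024 * l ^ 4) ≤ b := (le_div_iff₀ (by positivity)).1 hs₀b
        have h5 : 1 ≤ l ^ 4 := one_le_pow₀ hl1
        have h6 : (s₀ : ℝ) * (1024 * 1) ≤ s₀ * (1024 * l ^ 4) := by gcongr
        linarith
      have h4 : b / (2 * s₀) < (B.card / (2 * s₀) : ℕ) + 1 := by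
        rw [div_lt_iff₀ (by positivity)]; linarith
      have h5 : b / (4 * s₀) = b / (2 * s₀) / 2 := by field_simp; norm_num
      rw [h5]
      linarith
  have hνm : 2 * (ν : ℝ) ≤ m / l / 4 :=
    half_div_le hl hm0 hb0 hb'.le (le_trans (by linarith [show 0 ≤ w ^ 11 by positivity]) hs₀l) hνu
  have hs₀m : (s₀ : ℝ) ≤ m / (3072 * l ^ 2) := by
    have h1 : (m : ℝ) / (3072 * l ^ 2) = (10 ^ 6 / 3072) * (m / (10 ^ 6 * l ^ 2)) := by
      field_simp
    have h2 : 0 < (m : ℝ) / (10 ^ 6 * l ^ 2) := by positivity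
    rw [h1]
    linarith
  have hs₀m' : s₀ ≤ m := by
    have h1 : (m : ℝ) / (3072 * l ^ 2) ≤ m := by
      apply div_le_self hm0.le
      nlinarith
    exact_mod_cast hs₀m.trans h1
  have hmlm : (m : ℝ) / ((q : ℝ) + 1) ≤ m := div_le_self hm0.le (by linarith [q.cast_nonneg (α := ℝ)])
  have hs₁m : s₁ ≤ m := by
    have h1 : (u : ℝ) ≤ m := by linarith [show 0 ≤ (m : ℝ) / (q + 1) by positivity]
    have h2 : u ≤ m := by exact_mod_cast h1
    omega
  have z1 := three_mul_le hl hm0 hb'.le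
  have z2 : (m : ℝ) * l ^ 3 ≤ m ^ 2 / l ^ 2 / 10 ^ 7 := mul_cube_le hl1 (hw.trans hwm1)
  have hZ : ((m : ℝ) / l) ^ 2 = m ^ 2 / l ^ 2 := div_pow _ _ _
  set Z : ℝ := m ^ 2 / l ^ 2
  have hl3 : 1 ≤ l ^ 3 := one_le_pow₀ hl1
  have z3 : (m : ℝ) ≤ m * l ^ 3 := le_mul_of_one_le_right hm0.le hl3
  have z4 : ((q : ℝ) + 1) ^ 2 ≤ m := by
    calc ((q : ℝ) + 1) ^ 2 ≤ l ^ 2 := by gcongr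
      _ ≤ l ^ 10 := pow_le_pow_right₀ hl1 (by norm_num)
      _ ≤ m := by linarith
  have hl2 := Real.log_two_gt_d9
  have hl2' := Real.log_two_lt_d9
  have hcode : 16 * (l ^ 10) ^ (2 * (q + 1) + 3) * Real.log (Fintype.card (Fin m) + 1) ≤ w ^ 2 := by
    rw [Fintype.card_fin]
    exact code_le hl1 hw hL hLw (Real.log_nonneg (by linarith)) hlog
  refine card_completions_le q hq P B hBP hBd 𝓗 h𝓗 hclq hopt (exKr m (q + 1))
    (card_crossSet_le_exKr P) (m * l ^ 3 + 3 * b * l) (l ^ 10) s₀ s₁ u ν c₀ ?_ ?_ ?_ ?_ hL ?_ ?_ ?_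
    ?_ ?_ hνB ?_ hs₁u ?_
  · rintro ⟨i, hi⟩
    have e2 : (m : ℝ) / (2 * (q + 1)) = (m / ((q : ℝ) + 1)) / 2 := by field_simp
    have h1 := card_crossSet_le_of_small (m := m) (r := q + 1) (by omega) P i (by
      push_cast; rw [e2]; exact hc₀u _ hi)
    have h2 := turan_le_exKr (m := m) (r := q + 1) (by omega)
    push_cast at h1 h2
    have h3 : Z / 8 ≤ m ^ 2 / (8 * ((q : ℝ) + 1) ^ 2) := by
      rw [show Z = m ^ 2 / l ^ 2 from rfl, div_div, mul_comm (l ^ 2)]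
      gcongr
    have h4 : ((crossSet P).card : ℝ) ≤ exKr m (q + 1) - Z / 10 := by linarith
    have h5 : 0.6 * (Z / 10) ≤ Real.log 2 * (Z / 10) := by gcongr; linarith
    have h6 := mul_le_mul_of_nonneg_right h4 (by linarith : 0 ≤ Real.log 2)
    rw [sub_mul, mul_comm (Z / 10)] at h6
    linarith
  · rw [Fintype.card_fin]
    have : (q : ℝ) + 1 ≤ m := by linarith
    exact_mod_cast this
  · rwa [Fintype.card_fin]
  · rwa [Fintype.card_fin]
  · push_cast
    exact diag_loss_le hl (Nat.cast_nonneg q) hr rfl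
  · exact hcode.trans (le_trans (pow_le_pow_right₀ hw1 (by norm_num)) hs₀w)
  · exact hcode.trans (by linarith)
  · rw [Fintype.card_fin]
    exact entropy_le_sq hl1 hw hmw hb0 hs₀l
  · rw [Fintype.card_fin]
    have h1 : (m / l / 128) ^ 2 ≤ (s₁ : ℝ) ^ 2 := by gcongr
    have h2 : (m / l / 128) ^ 2 = Z / 16384 := by rw [div_pow, hZ]; norm_num
    have h3 : 0.17 * (s₁ : ℝ) ^ 2 ≤ Real.log 2 / 4 * s₁ ^ 2 := by gcongr; linarith
    have h4 : m * Real.log 2 ≤ m * 1 := by gcongr; linarith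
    linarith
  · have : ((u + 2 * ν : ℕ) : ℝ) ≤ c₀ := by push_cast; linarith
    exact_mod_cast this
  · refine le_mul_of_div_le hl1 hm0 hb0 hs₀0 hs₀m hs₀b hνl ?_
    have h1 : Real.log (q + 1) ≤ l := by
      have := Real.log_le_sub_one_of_pos (show (0 : ℝ) < q + 1 by positivity)
      linarith
    have h2 : (m : ℝ) / (128 * l) = m / l / 128 := by field_simp
    rw [h2]
    linarith

end ParameterChoice

section FarGraphs

lemma card_far_exp_le (m q : ℕ) [Nonempty (Fin m)] (𝒢 : Finset (Finset (Sym2 (Fin m)))) {L T : ℝ}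
    (hL : 1 ≤ L) (hdiag : ∀ G ∈ 𝒢, ∀ e ∈ G, ¬ e.IsDiag)
    (hclq : ∀ G ∈ 𝒢, ¬ HasClique G (q + 2) Finset.univ)
    (hfar : ∀ G ∈ 𝒢, ∀ P : Fin m → Fin (q + 1), T ≤ monoCard G P)
    (hcode : 8 * ((q : ℝ) + 2) * L ^ (2 * q + 7) * Real.log (m + 1) ≤ m) :
    (𝒢.card : ℝ) ≤ Real.exp (Real.log 2 * (exKr m (q + 1) - T) +
      (q + 5 + 2 * Real.log L) * m ^ 2 / L) := by
  have hm : 1 ≤ m := Fin.pos_iff_nonempty.2 inferInstance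
  have hfin : ∀ c : Fin m → ℕ, (∀ x, c x ≤ q) → ∃ P : Fin m → Fin (q + 1), c = fun x => (P x : ℕ) :=
    fun c hc => ⟨fun x => ⟨c x, Nat.lt_succ_of_le (hc x)⟩, rfl⟩
  have h := card_far_cliqueFree_le 𝒢 q L T (exKr m (q + 1)) hL hdiag hclq ?_ ?_ ?_
  · rwa [Fintype.card_fin] at h
  · intro G hG c hc
    obtain ⟨P, rfl⟩ := hfin c hc
    convert hfar G hG P using 2
    unfold monoCard
    congr 1
    refine Finset.filter_congr fun e _ => ?_
    induction e using Sym2.ind with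
    | _ x y => simp [Fin.val_inj]
  · intro c hc
    obtain ⟨P, rfl⟩ := hfin c hc
    have h1 : crossCard (fun x => (P x : ℕ)) = crossCard P := by
      simp only [crossCard, ne_eq, Fin.val_inj]
    rw [h1, ← two_mul_card_crossSet]
    exact_mod_cast Nat.mul_le_mul_left 2 (card_crossSet_le_exKr P)
  · rw [Fintype.card_fin]
    exact coding_bound m (q + 2) L hL (by omega) hm (by
      push_cast
      exact hcode)

/-- The count of far graphs, in terms of `w = m ^ (1 / 20)`. -/
lemma card_far_le (m q : ℕ) (hq : 1 ≤ q) {w l : ℝ}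
    (hmw : (m : ℝ) = w ^ 20) (hlm : l = Real.log m)
    (hl : 10 ^ 8 ≤ l) (hw : 10 ^ 9 * l ^ 10 ≤ w) (hr : (q : ℝ) + 1 ≤ l)
    (hLw : (l ^ 10) ^ (2 * q + 7) ≤ w) (𝒢 : Finset (Finset (Sym2 (Fin m))))
    (hdiag : ∀ G ∈ 𝒢, ∀ e ∈ G, ¬ e.IsDiag)
    (hclq : ∀ G ∈ 𝒢, ¬ HasClique G (q + 2) Finset.univ)
    (hfar : ∀ G ∈ 𝒢, ∀ P : Fin m → Fin (q + 1), w ^ 12 < monoCard G P) :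
    (𝒢.card : ℝ) ≤ 2 ^ exKr m (q + 1) * Real.exp (-(m * l ^ 3 / 2)) := by
  have hl1 : (1 : ℝ) ≤ l := le_trans (by norm_num) hl
  have hl0 : 0 < l := by linarith
  have hl10 : l ≤ l ^ 10 := le_self_pow₀ hl1 (by norm_num)
  have hl3 : l ≤ l ^ 3 := le_self_pow₀ hl1 (by norm_num)
  have hl32 : l * (10 ^ 8) ^ 2 ≤ l ^ 3 := by
    calc l * (10 ^ 8) ^ 2 ≤ l * l ^ 2 := by gcongr
      _ = l ^ 3 := by ring
  have hw1 : (1 : ℝ) ≤ w := by linarith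
  have hm0 : (0 : ℝ) < m := by rw [hmw]; positivity
  have hwm : w ^ 3 ≤ m := hmw ▸ pow_le_pow_right₀ hw1 (by norm_num)
  have hwm1 : w ≤ m := le_trans (le_self_pow₀ hw1 (by norm_num)) hwm
  have hm2 : 2 ≤ m := by
    have : (2 : ℝ) ≤ m := by linarith
    exact_mod_cast this
  have hlog : Real.log (m + 1) ≤ 2 * l := hlm ▸ log_add_one_le_two_mul hm2
  have hL : 1 ≤ l ^ 10 := one_le_pow₀ hl1
  have hl2 := Real.log_two_gt_d9
  have hl2' := Real.log_two_lt_d9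
  have : Nonempty (Fin m) := Fin.pos_iff_nonempty.1 (by omega)
  set T : ℝ := (m : ℝ) ^ 2 / l ^ 8 with hT
  set p : (Finset (Sym2 (Fin m))) → Prop := fun G => ∀ P : Fin m → Fin (q + 1), T ≤ monoCard G P
  have hsplit : (𝒢.card : ℝ) = (𝒢.filter p).card + (𝒢.filter fun G => ¬ p G).card := by
    exact_mod_cast (Finset.card_filter_add_card_filter_not p).symm
  have hpow : (2 : ℝ) ^ exKr m (q + 1) = Real.exp (Real.log 2 * exKr m (q + 1)) := by
    rw [mul_comm, Real.exp_nat_mul, Real.exp_log (by norm_num)]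
  have hhalf : (1 / 2 : ℝ) = Real.exp (-Real.log 2) := by
    rw [Real.exp_neg, Real.exp_log (by norm_num)]; norm_num
  have hfarT : ((𝒢.filter p).card : ℝ) ≤
      1 / 2 * (2 ^ exKr m (q + 1) * Real.exp (-(m * l ^ 3 / 2))) := by
    refine (card_far_exp_le m q _ hL (fun G hG => hdiag G (Finset.mem_filter.1 hG).1)
      (fun G hG => hclq G (Finset.mem_filter.1 hG).1) (fun G hG => (Finset.mem_filter.1 hG).2)
      ?_).trans ?_
    · have h1 : (q : ℝ) + 2 ≤ 2 * l := by linarith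
      calc 8 * ((q : ℝ) + 2) * (l ^ 10) ^ (2 * q + 7) * Real.log (m + 1)
          ≤ 8 * (2 * l) * w * (2 * l) := by
            have := Real.log_nonneg (show (1 : ℝ) ≤ m + 1 by linarith)
            gcongr
        _ = w * (32 * l ^ 2) := by ring
        _ ≤ w * (10 ^ 9 * l ^ 10) := by
          gcongr w * (?_ * l ^ ?_)
          · norm_num
          · norm_num
        _ ≤ w * w := by gcongr
        _ ≤ w ^ 3 := by rw [← sq]; exact pow_le_pow_right₀ hw1 (by norm_num)
        _ ≤ m := hwm
    · rw [hhalf, hpow, ← Real.exp_add, ← Real.exp_add, Real.exp_le_exp]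
      have h1 : Real.log (l ^ 10) ≤ 10 * l := by
        rw [Real.log_pow]
        push_cast
        have := Real.log_le_sub_one_of_pos hl0
        linarith
      have h2 : (q + 5 + 2 * Real.log (l ^ 10)) * m ^ 2 / l ^ 10 ≤ T / 10 ^ 6 := by
        calc (q + 5 + 2 * Real.log (l ^ 10)) * m ^ 2 / l ^ 10 ≤ 25 * l * m ^ 2 / l ^ 10 := by
              gcongr
              linarith
          _ = T * (25 / l) := by rw [hT]; field_simp
          _ ≤ T * (25 / 10 ^ 8) := by gcongr
          _ ≤ T / 10 ^ 6 := by
            have : 0 < T := by positivity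
            linarith
      have h3 : m * l ^ 3 ≤ T / 10 := by
        rw [hT, div_div, le_div_iff₀ (by positivity)]
        have h4 : l ^ 11 * 10 ≤ m := by
          refine le_trans ?_ hwm
          calc l ^ 11 * 10 ≤ l ^ 30 * (10 ^ 9) ^ 3 := by
                gcongr l ^ ?_ * ?_
                · norm_num
                · norm_num
            _ = (10 ^ 9 * l ^ 10) ^ 3 := by ring
            _ ≤ w ^ 3 := by gcongr
        calc (m : ℝ) * l ^ 3 * (l ^ 8 * 10) = (m : ℝ) * (l ^ 11 * 10) := by ring
          _ ≤ (m : ℝ) * m := by gcongr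
          _ = (m : ℝ) ^ 2 := by ring
      have h5 : m * 1 ≤ m * l ^ 3 := by gcongr; linarith
      have h6 : 0.6 * T ≤ Real.log 2 * T := by gcongr; linarith
      linarith
  have hnear : ((𝒢.filter fun G => ¬ p G).card : ℝ) ≤
      1 / 2 * (2 ^ exKr m (q + 1) * Real.exp (-(m * l ^ 3 / 2))) := by
    refine (card_far_near_le q (by rw [Fintype.card_fin]; omega) _ (w ^ 12) T
      (2 * (2 ^ exKr m (q + 1) * Real.exp (-(m * l ^ 3)))) (by positivity)
      (fun G hG => hdiag G (Finset.mem_filter.1 hG).1)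
      (fun G hG => hclq G (Finset.mem_filter.1 hG).1)
      (fun G hG => hfar G (Finset.mem_filter.1 hG).1) ?_ ?_).trans ?_
    · intro G hG
      have := (Finset.mem_filter.1 hG).2
      simpa [p] using this
    · intro P B 𝓗 hBP hBd hb hb' h𝓗 hclq' hopt
      refine (card_completions_le_exp m q hq hmw hlm hl hw hr hLw P B 𝓗 hBP hBd rfl hb hb' h𝓗
        hclq' hopt).trans (le_of_eq ?_)
      rw [Fintype.card_fin, ← hlm, neg_add, Real.exp_add]
      ring
    · rw [Fintype.card_fin]
      have h1 : ((q : ℝ) + 1) ^ m ≤ Real.exp (m * l) := by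
        rw [Real.exp_nat_mul]
        have := Real.add_one_le_exp l
        gcongr
        linarith
      have h2 : Real.exp (m * l) * 12 * Real.exp (-(m * l ^ 3)) ≤ Real.exp (-(m * l ^ 3 / 2)) := by
        have h3 : (12 : ℝ) ≤ Real.exp 12 := by linarith [Real.add_one_le_exp (12 : ℝ)]
        calc Real.exp (m * l) * 12 * Real.exp (-(m * l ^ 3))
            ≤ Real.exp (m * l) * Real.exp 12 * Real.exp (-(m * l ^ 3)) := by gcongr
          _ = Real.exp (m * l + 12 + -(m * l ^ 3)) := by rw [Real.exp_add, Real.exp_add]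
          _ ≤ _ := by
            rw [Real.exp_le_exp]
            have h4 : m * (l * (10 ^ 8) ^ 2) ≤ m * l ^ 3 := by gcongr
            have h5 : m * 1 ≤ m * l := by gcongr
            have h6 : (1 : ℝ) ≤ m := by linarith
            linarith
      calc ((q : ℝ) + 1) ^ m * (3 * (2 * (2 ^ exKr m (q + 1) * Real.exp (-(m * l ^ 3)))))
          ≤ Real.exp (m * l) * (3 * (2 * (2 ^ exKr m (q + 1) * Real.exp (-(m * l ^ 3))))) := by
            gcongr
        _ = 1 / 2 * 2 ^ exKr m (q + 1) * (Real.exp (m * l) * 12 * Real.exp (-(m * l ^ 3))) := by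
          ring
        _ ≤ 1 / 2 * 2 ^ exKr m (q + 1) * Real.exp (-(m * l ^ 3 / 2)) := by gcongr
        _ = _ := by ring
  rw [hsplit]
  linarith

end FarGraphs

theorem stmt14 :
    ∃ ε₀ : ℝ, 0 < ε₀ ∧ ∃ M : ℕ, ∀ m : ℕ, M ≤ m → ∀ r : ℕ, 2 ≤ r →
      (r : ℝ) ≤ ε₀ * Real.log m / Real.log (Real.log m) →
      (Nat.card {H : SimpleGraph (Fin m) // H.CliqueFree (r + 1) ∧
          GraphFarFromPartite H r ((m : ℝ) ^ (3 / 5 : ℝ))} : ℝ) ≤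
        2 ^ (exKr m r) * Real.exp (-(m : ℝ) * (Real.log m) ^ 3 / 2) := by
  have hlog : Filter.Tendsto (fun m : ℕ => Real.log m) Filter.atTop Filter.atTop :=
    Real.tendsto_log_atTop.comp tendsto_natCast_atTop_atTop
  have hev : ∀ᶠ l : ℝ in Filter.atTop, 10 ^ 8 ≤ l ∧ 10 ^ 9 * l ^ 10 ≤ Real.exp (l / 20) ∧
      50 * Real.log l ≤ l / 40 ∧ 1 ≤ Real.log l := by
    refine (Filter.eventually_ge_atTop _).and (Filter.Eventually.and ?_
      (Filter.Eventually.and ?_ (Real.tendsto_log_atTop.eventually_ge_atTop 1)))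
    · have h1 := (Real.tendsto_exp_div_pow_atTop 10).comp
        (Filter.tendsto_id.atTop_div_const (show (0 : ℝ) < 20 by norm_num))
      filter_upwards [h1.eventually_ge_atTop (10 ^ 9 * 20 ^ 10), Filter.eventually_gt_atTop 0]
        with l hl hl0
      simp only [Function.comp_apply, id] at hl
      rw [le_div_iff₀ (by positivity)] at hl
      refine le_trans (le_of_eq ?_) hl
      ring
    · have h1 := Real.isLittleO_log_id_atTop.bound (show (0 : ℝ) < 1 / 2000 by norm_num)
      filter_upwards [h1, Filter.eventually_ge_atTop 1] with l hl hl1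
      rw [Real.norm_of_nonneg (Real.log_nonneg hl1), id, Real.norm_of_nonneg (by linarith)] at hl
      linarith
  obtain ⟨M, hM⟩ := Filter.eventually_atTop.1 ((hlog.eventually hev).and
    (Filter.eventually_ge_atTop 1))
  refine ⟨1 / 800, by norm_num, M, fun m hm r hr hrl => ?_⟩
  obtain ⟨⟨hl, hw, hll, hll1⟩, hm1⟩ := hM m hm
  obtain ⟨q, rfl⟩ : ∃ q, r = q + 1 := ⟨r - 1, by omega⟩
  have hm0 : (0 : ℝ) < m := by exact_mod_cast hm1
  set l := Real.log m with hlm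
  have hl0 : 0 < l := lt_of_lt_of_le (by norm_num) hl
  have hml : (m : ℝ) = Real.exp l := (Real.exp_log hm0).symm
  have hmw : (m : ℝ) = Real.exp (l / 20) ^ 20 := by
    rw [hml, ← Real.exp_nat_mul]
    congr 1
    push_cast
    ring
  have ht : (m : ℝ) ^ (3 / 5 : ℝ) = Real.exp (l / 20) ^ 12 := by
    rw [hml, ← Real.exp_mul, ← Real.exp_nat_mul]
    congr 1
    push_cast
    ring
  rw [le_div_iff₀ (by linarith)] at hrl
  push_cast at hrl
  have hq0 : (0 : ℝ) ≤ q := q.cast_nonneg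
  have hrl' : (q : ℝ) + 1 ≤ l := by
    have : ((q : ℝ) + 1) * 1 ≤ (q + 1) * Real.log l := by gcongr
    linarith
  have hLw : (l ^ 10) ^ (2 * q + 7) ≤ Real.exp (l / 20) := by
    have h1 : (l ^ 10) ^ (2 * q + 7) = Real.exp ((10 * (2 * q + 7) : ℕ) * Real.log l) := by
      rw [Real.exp_nat_mul, Real.exp_log hl0, pow_mul]
    rw [h1, Real.exp_le_exp]
    push_cast
    linarith
  obtain ⟨𝒢, hcard, hdiag, hclq, hfar⟩ := exists_finset_card_eq m q ((m : ℝ) ^ (3 / 5 : ℝ))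
  rw [ht] at hfar
  have key := card_far_le m q (by omega) hmw hlm hl hw hrl' hLw 𝒢 hdiag hclq hfar
  rw [show q + 1 + 1 = q + 2 from rfl, hcard]
  refine key.trans (le_of_eq ?_)
  rw [neg_mul, neg_div]
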